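/- arXiv:0803.0707 — 3 statements merged into one kernel-verified Lean document; each statement's English description precedes it below -/
import Mathlib

section
/- Let p, q, s ≥ 1 be integers of the same odd-even parity and let n = (p+q)/2. Then a^{(s)}_{p,q,n+1} = 0; equivalently, for every pairing μ of [p]∪[q]' having at least one mixed pair, the permutation μ∘γ_{p,q}^{-1} has at most n cycles in its disjoint cycle representation. -/
/-- The number of cycles (orbits, counting fixed points as 1-cycles) in the disjoint
cycle representation of a permutation `σ` of a finite set. -/
noncomputable def cycleCount {α : Type*} [Fintype α] (σ : Equiv.Perm α) : ℕ :=
  Nat.card (Quotient (MulAction.orbitRel (Subgroup.zpowers σ) α))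

/-- `annCount p q s k = a^{(s)}_{p,q,k}`: the number of pairings (fixed-point-free
involutions) `μ` of `[p] ∪ [q]'` with exactly `s` mixed pairs such that
`μ ∘ γ_{p,q}⁻¹` has exactly `k` cycles, where `γ_{p,q} = (1 2 … p)(1' 2' … q')`. -/
noncomputable def annCount (p q s k : ℕ) : ℕ :=
  Nat.card {μ : Equiv.Perm (Fin p ⊕ Fin q) //
    (∀ v, μ (μ v) = v) ∧ (∀ v, μ v ≠ v) ∧
    (Finset.univ.filter fun i : Fin p => (μ (Sum.inl i)).isRight).card = s ∧
    cycleCount (μ * (Equiv.sumCongr (finRotate p) (finRotate q))⁻¹) = k}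

open Equiv in
theorem cc_mk_apply {α : Type*} (σ : Perm α) (x : α) :
    (Quotient.mk (MulAction.orbitRel (Subgroup.zpowers σ) α) (σ x)) = Quotient.mk _ x := by
  apply Quotient.sound
  exact ⟨⟨σ, Subgroup.mem_zpowers σ⟩, rfl⟩

open Equiv in
theorem cc_const {α β : Type*} (σ : Perm α) (f : α → β) (hf : ∀ x, f (σ x) = f x)
    (x y : α) (h : (MulAction.orbitRel (Subgroup.zpowers σ) α) x y) : f x = f y := by
  obtain ⟨⟨g, hg⟩, rfl⟩ := h
  obtain ⟨k, rfl⟩ := Subgroup.mem_zpowers_iff.1 hg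
  change f ((σ ^ k) y) = f y
  have hf' : ∀ x, f (σ⁻¹ x) = f x := fun x => by
    have := hf (σ⁻¹ x)
    simpa using this.symm
  induction k using Int.induction_on generalizing y with
  | zero => simp
  | succ i ih =>
    rw [zpow_add_one, Perm.mul_apply, ih _ (Subgroup.zpow_mem_zpowers σ _), hf]
  | pred i ih =>
    rw [zpow_sub_one, Perm.mul_apply, ih _ (Subgroup.zpow_mem_zpowers σ _), hf']

open Equiv in
theorem cc_swap {α : Type*} [Fintype α] [DecidableEq α] (σ : Perm α) (a b : α) :
    cycleCount (swap a b * σ) ≤ cycleCount σ + 1 := by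
  classical
  set σ' := swap a b * σ with hσ'
  let Q' := Quotient (MulAction.orbitRel (Subgroup.zpowers σ') α)
  let m : α → Q' := fun x => Quotient.mk _ x
  let f : α → Q' := fun x => if m x = m a then m b else m x
  have hm : ∀ x, m (σ' x) = m x := fun x => cc_mk_apply σ' x
  have hs : ∀ y, f (swap a b y) = f y := by
    intro y
    by_cases h1 : y = a
    · subst h1; simp [f]
    by_cases h2 : y = b
    · subst h2; simp [f]
    rw [swap_apply_of_ne_of_ne h1 h2]
  have hf : ∀ x, f (σ x) = f x := by
    intro x
    have h1 : σ x = swap a b (σ' x) := by simp [hσ']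
    rw [h1, hs]
    simp only [f, hm]
  let F : Quotient (MulAction.orbitRel (Subgroup.zpowers σ) α) → Q' :=
    Quotient.lift f (fun x y h => cc_const σ f hf x y h)
  let G : Option (Quotient (MulAction.orbitRel (Subgroup.zpowers σ) α)) → Q' :=
    fun o => o.elim (m a) F
  have hG : Function.Surjective G := by
    intro z
    induction z using Quotient.inductionOn with
    | h x =>
      by_cases h : m x = m a
      · exact ⟨none, h.symm⟩
      · refine ⟨some (Quotient.mk _ x), ?_⟩
        change f x = m x
        simp [f, h]
  have := Nat.card_le_card_of_surjective G hG
  rw [Finite.card_option] at this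
  exact this

open Equiv in
theorem cc_invol {α : Type*} [Fintype α] [DecidableEq α] (k : ℕ) :
    ∀ (μ σ : Perm α), (∀ v, μ (μ v) = v) → μ.support.card ≤ k →
      2 * cycleCount (μ * σ) ≤ 2 * cycleCount σ + μ.support.card := by
  induction k with
  | zero =>
    intro μ σ _ h
    have : μ = 1 := by simpa using h
    subst this; simp
  | succ k ih =>
    intro μ σ h hk
    by_cases h1 : μ = 1
    · subst h1; simp
    obtain ⟨a, ha⟩ : ∃ a, μ a ≠ a := by
      by_contra hc
      push Not at hc
      exact h1 (Equiv.ext hc)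
    set ν := swap a (μ a) * μ with hν
    have hμ : μ = swap a (μ a) * ν := by simp [hν, ← mul_assoc]
    have hν1 : ν a = a := by simp [hν]
    have hν2 : ν (μ a) = μ a := by simp [hν, h]
    have hν3 : ∀ v, v ≠ a → v ≠ μ a → ν v = μ v := by
      intro v h2 h3
      simp only [hν, Perm.mul_apply]
      apply swap_apply_of_ne_of_ne
      · intro h4; apply h3; rw [← h4, h]
      · intro h4; exact h2 (μ.injective h4)
    have hsub : ν.support ⊆ (μ.support.erase a).erase (μ a) := by
      intro v hv
      have hv' := Perm.mem_support.1 hv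
      have h2 : v ≠ a := by rintro rfl; exact hv' hν1
      have h3 : v ≠ μ a := by rintro rfl; exact hv' hν2
      rw [hν3 v h2 h3] at hv'
      simp [h2, h3, hv']
    have hc := Finset.card_le_card hsub
    have hma : a ∈ μ.support := by simpa using ha
    have hmb : μ a ∈ μ.support.erase a := by simp [ha]
    have c1 := Finset.card_erase_add_one hma
    have c2 := Finset.card_erase_add_one hmb
    have hνi : ∀ v, ν (ν v) = v := by
      intro v
      by_cases h2 : v = a
      · rw [h2, hν1, hν1]
      by_cases h3 : v = μ a
      · rw [h3, hν2, hν2]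
      rw [hν3 v h2 h3, hν3, h]
      · intro h4; apply h3; rw [← h4, h]
      · intro h4; exact h2 (μ.injective h4)
    have i1 := ih ν σ hνi (by omega)
    have i2 := cc_swap (ν * σ) a (μ a)
    rw [← mul_assoc, ← hμ] at i2
    omega

theorem cc_rot {β : Type*} (p : ℕ) (f : Fin p → β) (hf : ∀ i, f (finRotate p i) = f i)
    (i j : Fin p) : f i = f j := by
  cases p with
  | zero => exact i.elim0
  | succ m =>
    have key : ∀ k (hk : k < m + 1), f ⟨k, hk⟩ = f 0 := by
      intro k
      induction k with
      | zero => intro _; rfl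
      | succ k ih =>
        intro hk
        rw [← ih (by omega), ← hf ⟨k, by omega⟩, finRotate_of_lt (by omega)]
    rw [key i.1 i.2, key j.1 j.2]

theorem cc_side {β : Type*} (p : ℕ) (a : Fin p) (f : Fin p → β)
    (hf : ∀ i, i ≠ a → f (finRotate p i) = f i) : f (finRotate p a) = f a := by
  by_contra hc
  have h : ∀ k : ℕ, f ((finRotate p ^ k) (finRotate p a)) = f (finRotate p a) := by
    intro k
    induction k with
    | zero => rfl
    | succ k ih =>
      rw [pow_succ', Equiv.Perm.mul_apply, hf _ ?_, ih]
      intro h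
      rw [h] at ih
      exact hc ih.symm
  have h1 := h (orderOf (finRotate p) - 1)
  rw [← Equiv.Perm.mul_apply, ← pow_succ, Nat.sub_add_cancel (orderOf_pos _),
    pow_orderOf_eq_one] at h1
  exact hc h1.symm

open Equiv in
theorem cc_join (p q : ℕ) (a : Fin p) (b : Fin q) :
    cycleCount (swap (Sum.inl a) (Sum.inr b) * (Equiv.sumCongr (finRotate p) (finRotate q))⁻¹)
      ≤ 1 := by
  set γ : Perm (Fin p ⊕ Fin q) := Equiv.sumCongr (finRotate p) (finRotate q) with hγ
  set σ' := swap (Sum.inl a) (Sum.inr b) * γ⁻¹ with hσ'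
  let Q' := Quotient (MulAction.orbitRel (Subgroup.zpowers σ') (Fin p ⊕ Fin q))
  let m : Fin p ⊕ Fin q → Q' := fun x => Quotient.mk _ x
  have hm : ∀ x, m (swap (Sum.inl a) (Sum.inr b) x) = m (γ x) := fun x => by
    have := cc_mk_apply σ' (γ x)
    simpa [hσ'] using this
  have hl : ∀ i, γ (Sum.inl i) = Sum.inl (finRotate p i) := fun i => rfl
  have hr : ∀ i, γ (Sum.inr i) = Sum.inr (finRotate q i) := fun i => rfl
  have l1 : ∀ i, i ≠ a → m (Sum.inl (finRotate p i)) = m (Sum.inl i) := by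
    intro i hi
    rw [← hl, ← hm, swap_apply_of_ne_of_ne (by simpa using hi) (by simp)]
  have r1 : ∀ i, i ≠ b → m (Sum.inr (finRotate q i)) = m (Sum.inr i) := by
    intro i hi
    rw [← hr, ← hm, swap_apply_of_ne_of_ne (by simp) (by simpa using hi)]
  have l2 := cc_side p a (fun i => m (Sum.inl i)) l1
  have r2 := cc_side q b (fun i => m (Sum.inr i)) r1
  have l3 := cc_rot p (fun i => m (Sum.inl i)) (fun i => by
    by_cases h : i = a
    · subst h; exact l2
    · exact l1 i h)
  have r3 := cc_rot q (fun i => m (Sum.inr i)) (fun i => by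
    by_cases h : i = b
    · subst h; exact r2
    · exact r1 i h)
  have hab : m (Sum.inr b) = m (Sum.inl a) := by
    have := hm (Sum.inl a)
    rw [swap_apply_left, hl] at this
    exact this.trans l2
  have hall : ∀ x, m x = m (Sum.inl a) := by
    rintro (i | i)
    · exact l3 i a
    · exact (r3 i b).trans hab
  have : Subsingleton Q' := ⟨fun x y => by
    induction x using Quotient.inductionOn
    induction y using Quotient.inductionOn
    exact (hall _).trans (hall _).symm⟩
  exact Finite.card_le_one_iff_subsingleton.2 this

open Equiv in
theorem cc_main (p q n : ℕ) (hn : p + q = 2 * n) (μ : Equiv.Perm (Fin p ⊕ Fin q))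
    (h : ∀ v, μ (μ v) = v) (hfp : ∀ v, μ v ≠ v)
    (hx : ∃ i : Fin p, (μ (Sum.inl i)).isRight) :
    cycleCount (μ * (Equiv.sumCongr (finRotate p) (finRotate q))⁻¹) ≤ n := by
  obtain ⟨i, hi⟩ := hx
  obtain ⟨b, hb⟩ := Sum.isRight_iff.1 hi
  have hb' : μ (Sum.inr b) = Sum.inl i := by rw [← hb, h]
  set t := swap (Sum.inl i : Fin p ⊕ Fin q) (Sum.inr b) with ht
  set ν := μ * t with hν
  have hμ : μ = ν * t := by simp [hν, ht, mul_assoc]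
  have hν1 : ν (Sum.inl i) = Sum.inl i := by simp [hν, ht, hb']
  have hν2 : ν (Sum.inr b) = Sum.inr b := by simp [hν, ht, hb]
  have hν3 : ∀ v, v ≠ Sum.inl i → v ≠ Sum.inr b → ν v = μ v := by
    intro v h1 h2
    rw [hν, Perm.mul_apply, ht, swap_apply_of_ne_of_ne h1 h2]
  have hνi : ∀ v, ν (ν v) = v := by
    intro v
    by_cases h2 : v = Sum.inl i
    · rw [h2, hν1, hν1]
    by_cases h3 : v = Sum.inr b
    · rw [h3, hν2, hν2]
    rw [hν3 v h2 h3, hν3, h]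
    · intro h4; apply h3; rw [← h v, h4, hb]
    · intro h4; apply h2; rw [← h v, h4, hb']
  have hsub : ν.support ⊆ (Finset.univ.erase (Sum.inl i)).erase (Sum.inr b) := by
    intro v hv
    have hv' := Perm.mem_support.1 hv
    have h2 : v ≠ Sum.inl i := by rintro rfl; exact hv' hν1
    have h3 : v ≠ Sum.inr b := by rintro rfl; exact hv' hν2
    simp [h2, h3]
  have hc := Finset.card_le_card hsub
  have c1 := Finset.card_erase_add_one (Finset.mem_univ (Sum.inl i : Fin p ⊕ Fin q))
  have c2 := Finset.card_erase_add_one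
    (show (Sum.inr b : Fin p ⊕ Fin q) ∈ Finset.univ.erase (Sum.inl i) by simp)
  have c3 : (Finset.univ : Finset (Fin p ⊕ Fin q)).card = p + q := by simp
  have i1 := cc_invol _ ν (t * (Equiv.sumCongr (finRotate p) (finRotate q))⁻¹) hνi le_rfl
  rw [← mul_assoc, ← hμ] at i1
  have i2 := cc_join p q i b
  rw [← ht] at i2
  omega

/-- `a^{(s)}_{p,q,n+1} = 0`; equivalently, for every pairing `μ` of `[p] ∪ [q]'` with at
least one mixed pair, the permutation `μ ∘ γ_{p,q}⁻¹` has at most `n` cycles. -/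
theorem vanishing_above_n (p q s n : ℕ) (hp : 1 ≤ p) (hq : 1 ≤ q) (hs : 1 ≤ s)
    (hps : p % 2 = s % 2) (hqs : q % 2 = s % 2) (hn : p + q = 2 * n) :
    annCount p q s (n + 1) = 0 ∧
      ∀ μ : Equiv.Perm (Fin p ⊕ Fin q), (∀ v, μ (μ v) = v) → (∀ v, μ v ≠ v) →
        (∃ i : Fin p, (μ (Sum.inl i)).isRight) →
        cycleCount (μ * (Equiv.sumCongr (finRotate p) (finRotate q))⁻¹) ≤ n := by
  have main := cc_main p q n hn
  refine ⟨?_, main⟩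
  unfold annCount
  rw [Nat.card_eq_zero]
  left
  refine ⟨fun ⟨μ, h1, h2, h3, h4⟩ => ?_⟩
  have hpos : 0 < (Finset.univ.filter fun i : Fin p => (μ (Sum.inl i)).isRight).card := by omega
  obtain ⟨i, hi⟩ := Finset.card_pos.1 hpos
  have := main μ h1 h2 ⟨i, (Finset.mem_filter.1 hi).2⟩
  omega
end

section
/- Let p, q, s ≥ 1 be integers of the same odd-even parity and let n = (p+q)/2. Then a^{(s)}_{p,q,n} = s · binom(p, (p−s)/2) · binom(q, (q−s)/2), with the convention that the binomial coefficients are 0 when their lower entry is negative. -/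
/-- `binom(a, b)` for integers, with the convention that it is `0` unless `0 ≤ b ≤ a`. -/
def ichoose (a b : ℤ) : ℤ := if 0 ≤ b ∧ b ≤ a then (a.toNat).choose b.toNat else 0

open Equiv Equiv.Perm
set_option linter.unusedSectionVars false
section PC
variable {α : Type*} [Fintype α] [DecidableEq α]

theorem pc_cc (σ : Perm α) : cycleCount σ = Nat.card (Quotient (SameCycle.setoid σ)) := by
  unfold cycleCount
  congr 2
  ext x y
  rw [MulAction.orbitRel_apply, MulAction.mem_orbit_iff]
  constructor
  · rintro ⟨⟨g, k, rfl⟩, h⟩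
    exact SameCycle.symm ⟨k, h⟩
  · intro h
    obtain ⟨k, h⟩ := SameCycle.symm h
    exact ⟨⟨σ ^ k, k, rfl⟩, h⟩

/-- invariant functions are constant on cycles -/
theorem pc_inv {β : Type*} (σ : Perm α) (f : α → β) (hf : ∀ v, f (σ v) = f v) {x y : α}
    (h : SameCycle σ x y) : f x = f y := by
  obtain ⟨k, -, -, rfl⟩ := h.exists_pow_eq''
  clear h
  induction k with
  | zero => rfl
  | succ k ih => rw [pow_succ', Perm.mul_apply, hf]; exact ih

theorem pc_le (σ τ : Perm α) (f : Perm α) (h : ∀ v, SameCycle τ (f (σ v)) (f v)) :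
    cycleCount τ ≤ cycleCount σ := by
  classical
  rw [pc_cc, pc_cc]
  let F : Quotient (SameCycle.setoid σ) → Quotient (SameCycle.setoid τ) :=
    Quotient.lift (fun v => Quotient.mk (SameCycle.setoid τ) (f v)) (by
      intro a b hab
      exact pc_inv σ (fun v => Quotient.mk (SameCycle.setoid τ) (f v))
        (fun v => Quotient.sound (h v)) hab)
  refine Nat.card_le_card_of_surjective F ?_
  intro q
  induction q using Quotient.inductionOn with
  | h v => exact ⟨Quotient.mk _ (f.symm v), by simp [F]⟩

theorem pc_conj (σ τ : Perm α) : cycleCount (τ * σ * τ⁻¹) = cycleCount σ := by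
  apply le_antisymm
  · apply pc_le _ _ τ
    intro v
    have : τ (σ v) = (τ * σ * τ⁻¹) (τ v) := by simp
    rw [this]; exact (sameCycle_apply_left).2 (SameCycle.refl _ _)
  · apply pc_le _ _ τ⁻¹
    intro v
    have : τ⁻¹ ((τ * σ * τ⁻¹) v) = σ (τ⁻¹ v) := by simp
    rw [this]; exact (sameCycle_apply_left).2 (SameCycle.refl _ _)

theorem pc_inverse (σ : Perm α) : cycleCount σ⁻¹ = cycleCount σ := by
  have key : ∀ σ : Perm α, cycleCount σ⁻¹ ≤ cycleCount σ := by
    intro σ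
    apply pc_le _ _ 1
    intro v
    exact sameCycle_inv.2 ((sameCycle_apply_left).2 (SameCycle.refl _ _))
  apply le_antisymm (key _)
  simpa using key σ⁻¹

theorem pc_comm (σ τ : Perm α) : cycleCount (σ * τ) = cycleCount (τ * σ) := by
  rw [← pc_conj (τ * σ) σ]; congr 1; group

theorem pc_one : cycleCount (1 : Perm α) = Fintype.card α := by
  rw [pc_cc, ← Nat.card_eq_fintype_card]
  refine (Nat.card_congr (Equiv.ofBijective (Quotient.mk (SameCycle.setoid (1 : Perm α))) ⟨?_, ?_⟩)).symm
  · intro a b h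
    have := Quotient.exact h
    exact sameCycle_one.1 this
  · exact Quotient.mk_surjective

/-- multiplying by a transposition loses at most one cycle -/
theorem pc_swap_ge (σ : Perm α) (x y : α) : cycleCount σ ≤ cycleCount (σ * swap x y) + 1 := by
  classical
  rw [pc_cc, pc_cc]
  let s := SameCycle.setoid σ
  let g : α → Quotient s := fun v => if Quotient.mk s v = Quotient.mk s y then Quotient.mk s x else Quotient.mk s v
  have hσ : ∀ v, Quotient.mk s (σ v) = Quotient.mk s v := fun v =>
    Quotient.sound ((sameCycle_apply_left).2 (SameCycle.refl σ v))
  have hg : ∀ v, g ((σ * swap x y) v) = g v := by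
    intro v
    simp only [g, Perm.mul_apply, hσ]
    by_cases h1 : v = x
    · subst h1; simp
    by_cases h2 : v = y
    · subst h2; simp
    rw [swap_apply_of_ne_of_ne h1 h2]
  let F : Option (Quotient (SameCycle.setoid (σ * swap x y))) → Quotient s := fun o =>
    o.elim (Quotient.mk s y) (Quotient.lift g (fun a b hab => pc_inv _ g hg hab))
  have := Nat.card_le_card_of_surjective F (by
    intro q
    induction q using Quotient.inductionOn with
    | h v =>
      by_cases h : Quotient.mk s v = Quotient.mk s y
      · exact ⟨none, h.symm⟩
      · exact ⟨some (Quotient.mk _ v), by simp [F, g, h]⟩)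
  simpa [Finite.card_option] using this

theorem pc_swap_le (σ : Perm α) (x y : α) : cycleCount (σ * swap x y) ≤ cycleCount σ + 1 := by
  have := pc_swap_ge (σ * swap x y) x y
  simpa [mul_assoc] using this

theorem pc_merge (σ : Perm α) (x y : α) (h : ¬ SameCycle σ x y) :
    cycleCount (σ * swap x y) + 1 = cycleCount σ := by
  classical
  have hxy : x ≠ y := fun e => h (e ▸ SameCycle.refl _ _)
  set τ := σ * swap x y with hτ
  have step : ∀ v, SameCycle τ v (τ v) := fun v => (sameCycle_apply_right).2 (SameCycle.refl _ _)
  have hτx : τ x = σ y := by simp [hτ]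
  have hτy : τ y = σ x := by simp [hτ]
  have hτv : ∀ v, v ≠ x → v ≠ y → τ v = σ v := fun v h1 h2 => by
    simp [hτ, swap_apply_of_ne_of_ne h1 h2]
  have key : ∀ i : ℕ, SameCycle τ x ((σ ^ (i+1)) y) := by
    intro i
    induction i with
    | zero => rw [zero_add, pow_one, ← hτx]; exact step x
    | succ i ih =>
      rw [pow_succ', Perm.mul_apply]
      by_cases h1 : (σ ^ (i+1)) y = y
      · rw [h1, ← hτx]; exact step x
      · rw [← hτv _ _ h1]
        · exact ih.trans (step _)
        · intro e
          exact h (SameCycle.symm ⟨(i+1 : ℕ), by rw [zpow_natCast]; exact e⟩)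
  have hxy' : SameCycle τ x y := by
    have := key (orderOf σ - 1)
    rwa [Nat.sub_add_cancel (orderOf_pos σ), pow_orderOf_eq_one] at this
  have hr : ∀ v, SameCycle τ (σ v) v := by
    intro v
    by_cases h1 : v = x
    · subst h1; rw [← hτy]; exact ((hxy'.trans (step y))).symm
    by_cases h2 : v = y
    · subst h2; rw [← hτx]; exact ((hxy'.symm.trans (step x))).symm
    rw [← hτv v h1 h2]; exact (step v).symm
  apply le_antisymm _ (pc_swap_ge σ x y)
  rw [pc_cc, pc_cc]
  let F : Quotient (SameCycle.setoid σ) → Quotient (SameCycle.setoid τ) :=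
    Quotient.lift (fun v => Quotient.mk (SameCycle.setoid τ) v) (by
      intro a b hab
      exact pc_inv σ (fun v => Quotient.mk (SameCycle.setoid τ) v)
        (fun v => Quotient.sound (hr v)) hab)
  have hs : Function.Surjective F := by
    intro q
    induction q using Quotient.inductionOn with
    | h v => exact ⟨Quotient.mk _ v, rfl⟩
  rw [Nat.add_one_le_iff]
  have hle := Nat.card_le_card_of_surjective F hs
  refine lt_of_le_of_ne hle ?_
  intro e
  have hb := (Nat.bijective_iff_surjective_and_card F).2 ⟨hs, e.symm⟩
  have : Quotient.mk (SameCycle.setoid σ) x = Quotient.mk (SameCycle.setoid σ) y :=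
    hb.1 (Quotient.sound hxy')
  exact h (Quotient.exact this)
end PC
section PC
variable {α : Type*} [Fintype α] [DecidableEq α]

theorem pc_insert (μ : Perm α) (y : α) (T : List α) (hT : T ≠ []) (hy : y ∉ T) (hμ : μ y = y) :
    cycleCount (μ * (y :: T).formPerm) + 1 = cycleCount (μ * T.formPerm) := by
  obtain ⟨z, T', rfl⟩ := List.exists_cons_of_ne_nil hT
  rw [List.formPerm_cons_cons]
  have h1 : cycleCount (μ * (swap y z * (z :: T').formPerm)) =
      cycleCount (((z :: T').formPerm * μ) * swap y z) := by
    rw [← mul_assoc, pc_comm, mul_assoc]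
  rw [h1, pc_merge, pc_comm]
  intro h
  have hfix : ((z :: T').formPerm * μ) y = y := by
    rw [Perm.mul_apply, hμ, List.formPerm_apply_of_notMem hy]
  have := pc_inv _ (fun v => v = y) (by
    intro v
    simp only [eq_iff_iff]
    constructor
    · intro h
      exact (((z :: T').formPerm * μ).injective (h.trans hfix.symm))
    · rintro rfl; exact hfix) h
  simp only [eq_iff_iff, true_iff] at this
  exact hy (by simp [this])

theorem pc_formPerm (m : α) (L : List α) (h : (m :: L).Nodup) :
    cycleCount (m :: L).formPerm + L.length = Fintype.card α := by
  induction L generalizing m with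
  | nil => simp [pc_one]
  | cons a L ih =>
    have h' := List.nodup_cons.1 h
    have := pc_insert 1 m (a :: L) (by simp) h'.1 rfl
    rw [one_mul, one_mul] at this
    have := ih a h'.2
    simp only [List.length_cons]
    omega

theorem pc_euler (σ : Perm α) (N : ℕ) : ∀ (μ : Perm α), (∀ v, μ (μ v) = v) → μ.support.card = N →
    2 * cycleCount (μ * σ) ≤ 2 * cycleCount σ + N := by
  induction N using Nat.strong_induction_on with
  | _ N ih =>
    intro μ hμ hN
    by_cases h1 : μ = 1
    · subst h1; rw [one_mul]; omega
    obtain ⟨v, hv⟩ : ∃ v, μ v ≠ v := by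
      by_contra hc
      push Not at hc
      exact h1 (Perm.ext hc)
    have hsupp : (swap v (μ v) * μ).support = μ.support \ {v, μ v} := by
      ext w
      simp only [Perm.mem_support, Perm.mul_apply, Finset.mem_sdiff, Finset.mem_insert, Finset.mem_singleton]
      by_cases hw : w = v
      · subst hw; simp
      by_cases hw2 : w = μ v
      · subst hw2; simp [hμ]
      rw [swap_apply_of_ne_of_ne]
      · simp [hw, hw2]
      · intro e; apply hw2; rw [← e, hμ]
      · intro e; exact hw (μ.injective e)
    have hsub : ({v, μ v} : Finset α) ⊆ μ.support := by
      intro w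
      simp only [Finset.mem_insert, Finset.mem_singleton, Perm.mem_support]
      rintro (rfl | rfl)
      · exact hv
      · rw [hμ]; exact hv.symm
    have hc : (swap v (μ v) * μ).support.card + 2 = N := by
      rw [hsupp, Finset.card_sdiff_of_subset hsub, Finset.card_pair hv.symm]
      have := Finset.card_le_card hsub
      rw [Finset.card_pair hv.symm] at this
      omega
    have h2 := ih (N - 2) (by omega) (swap v (μ v) * μ) (by
      intro w
      simp only [Perm.mul_apply]
      by_cases hw : w = v
      · subst hw; simp
      by_cases hw2 : w = μ v
      · subst hw2; simp [hμ]
      rw [swap_apply_of_ne_of_ne (a := v) (b := μ v) (x := μ w), hμ, swap_apply_of_ne_of_ne hw hw2]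
      · intro e; apply hw2; rw [← e, hμ]
      · intro e; exact hw (μ.injective e)) (by omega)
    have h3 := pc_swap_ge (swap v (μ v) * μ * σ)⁻¹ v (μ v)
    have h4 := pc_swap_le (swap v (μ v) * μ * σ)⁻¹ v (μ v)
    have e : (swap v (μ v) * μ * σ)⁻¹ * swap v (μ v) = (μ * σ)⁻¹ := by
      simp [mul_inv_rev, mul_assoc]
    rw [e] at h4
    simp only [pc_inverse] at h4
    omega

theorem pc_form_append (l : List α) (v : α) (r : List α) :
    (l ++ v :: r).formPerm = (l ++ [v]).formPerm * (v :: r).formPerm := by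
  induction l with
  | nil => simp
  | cons a l ih =>
    cases l with
    | nil => simp [List.formPerm_cons_cons]
    | cons b l =>
      simp only [List.cons_append, List.formPerm_cons_cons] at ih ⊢
      rw [ih, mul_assoc]

theorem pc_cut (y j : α) (C D : List α) (h : (y :: C ++ j :: D).Nodup) :
    swap y j * (y :: C ++ j :: D).formPerm = (y :: C).formPerm * (j :: D).formPerm := by
  rw [pc_form_append]
  have h1 : (y :: C ++ [j]).Nodup :=
    h.sublist (List.Sublist.append_left (List.singleton_sublist.2 (by simp)) _)
  have h2 : (y :: C ++ [j]) ~r ([j] ++ (y :: C)) := List.isRotated_append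
  rw [List.formPerm_eq_of_isRotated h1 h2]
  simp only [List.singleton_append, List.formPerm_cons_cons]
  rw [swap_comm j y, ← mul_assoc, swap_mul_self_mul]

theorem pc_cross (y j x k : α) (C D : List α) (h : (y :: C ++ j :: D).Nodup)
    (hx : x ∈ D) (hk : k ∈ C) :
    cycleCount (swap x k * (swap y j * (y :: C ++ j :: D).formPerm)) ≤
      cycleCount (y :: C ++ j :: D).formPerm := by
  have h1 := pc_swap_le (y :: C ++ j :: D).formPerm y j
  rw [pc_comm] at h1
  rw [pc_cut y j C D h] at h1 ⊢
  rw [pc_comm (swap x k)]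
  have := pc_merge ((y :: C).formPerm * (j :: D).formPerm) x k (by
    intro hs
    have hdis := (List.nodup_append.1 h).2.2
    have := pc_inv _ (fun v => v ∈ y :: C) (by
      intro v
      simp only [Perm.mul_apply, eq_iff_iff, List.formPerm_mem_iff_mem]
      by_cases hv : v ∈ j :: D
      · have h2 : (j :: D).formPerm v ∈ j :: D := List.formPerm_mem_iff_mem.2 hv
        constructor
        · intro h3; exact absurd rfl (hdis _ h3 _ h2)
        · intro h3; exact absurd rfl (hdis _ h3 _ hv)
      · rw [List.formPerm_apply_of_notMem hv]) hs
    have h4 : x ∈ y :: C := by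
      have : (x ∈ y :: C) = (k ∈ y :: C) := this
      rw [this]; simp [hk]
    exact hdis _ h4 x (by simp [hx]) rfl)
  omega

/-- noncrossing -/
theorem pc_noncross (μ : Perm α) (hμ : ∀ v, μ (μ v) = v) (m x y : α) (S R : List α)
    (hnd : (m :: (S ++ x :: y :: R)).Nodup)
    (hsupp : ∀ v, μ v ≠ v → v ∈ S ++ x :: y :: R)
    (hg : 2 * Fintype.card α ≤ 2 * cycleCount (μ * (m :: (S ++ x :: y :: R)).formPerm) +
      (S ++ x :: y :: R).length)
    (hy : μ y ∈ S) (hx : μ x ∈ R) : False := by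
  obtain ⟨S1, S2, hS⟩ := List.append_of_mem hy
  set j := μ y with hj
  set k := μ x with hk
  set L := S ++ x :: y :: R with hL
  have hrot : (m :: L) ~r (y :: (R ++ m :: S1) ++ j :: (S2 ++ [x])) := by
    have : m :: L = (m :: S1 ++ j :: (S2 ++ [x])) ++ y :: R := by simp [hL, hS]
    rw [this]
    have h2 : y :: (R ++ m :: S1) ++ j :: (S2 ++ [x]) = (y :: R) ++ (m :: S1 ++ j :: (S2 ++ [x])) := by simp
    rw [h2]
    exact List.isRotated_append
  have hc := List.formPerm_eq_of_isRotated hnd hrot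
  have hnd' := hrot.nodup_iff.1 hnd
  have h1 := pc_cross y j x k _ _ hnd' (by simp) (by simp [hx])
  rw [← hc] at h1
  have h2 := pc_formPerm m L hnd
  have hxy : x ≠ y := by
    rintro rfl
    rw [hL] at hnd; simp [List.nodup_append] at hnd
  have hyj : j ≠ y := by
    intro e
    rw [e] at hnd'
    simp at hnd'
  have hxk : k ≠ x := by
    intro e
    rw [e] at hx
    rw [hL] at hnd; simp [List.nodup_append, hx] at hnd
  have hky : k ≠ y := by
    intro e
    rw [e] at hx
    rw [hL] at hnd; simp [List.nodup_append, hx] at hnd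
  have hjx : j ≠ x := by
    intro e
    apply hky; rw [hk, ← e, hj, hμ]
  have hjk : j ≠ k := fun e => hxy (μ.injective e.symm)
  have hμj : μ j = y := hμ y
  have hμk : μ k = x := hμ x
  set ν := μ * swap y j * swap x k with hν
  have hνy : ν y = y := by
    simp only [hν, Perm.mul_apply]
    rw [swap_apply_of_ne_of_ne hxy.symm hky.symm, swap_apply_left, hμj]
  have hνj : ν j = j := by
    simp only [hν, Perm.mul_apply]
    rw [swap_apply_of_ne_of_ne hjx hjk, swap_apply_right]
  have hνx : ν x = x := by
    simp only [hν, Perm.mul_apply]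
    rw [swap_apply_left, swap_apply_of_ne_of_ne hky hjk.symm, hμk]
  have hνk : ν k = k := by
    simp only [hν, Perm.mul_apply]
    rw [swap_apply_right, swap_apply_of_ne_of_ne hxy hjx.symm]
  have hνv : ∀ v, v ≠ y → v ≠ j → v ≠ x → v ≠ k → ν v = μ v := by
    intro v a b c d
    simp only [hν, Perm.mul_apply]
    rw [swap_apply_of_ne_of_ne c d, swap_apply_of_ne_of_ne a b]
  have hinv : ∀ v, ν (ν v) = v := by
    intro v
    by_cases a : v = y
    · rw [a, hνy, hνy]
    by_cases b : v = j
    · rw [b, hνj, hνj]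
    by_cases c : v = x
    · rw [c, hνx, hνx]
    by_cases d : v = k
    · rw [d, hνk, hνk]
    rw [hνv v a b c d, hνv, hμ]
    · intro e; apply b; rw [hj, ← e, hμ]
    · intro e; apply a; apply μ.injective e
    · intro e; apply d; rw [hk, ← e, hμ]
    · intro e; apply c; apply μ.injective e
  have hcard : ν.support.card + 4 ≤ L.length := by
    have hsub : ν.support ∪ {y, j, x, k} ⊆ L.toFinset := by
      intro v
      rw [Finset.mem_union]
      simp only [Finset.mem_insert, Finset.mem_singleton, Perm.mem_support, List.mem_toFinset]
      intro hv
      by_cases a : v = y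
      · simp [a, hL]
      by_cases b : v = j
      · simp [b, hL, hy]
      by_cases c : v = x
      · simp [c, hL]
      by_cases d : v = k
      · simp [d, hL, hx]
      rw [hνv v a b c d] at hv
      simp only [a, b, c, d, or_false] at hv
      exact hsupp v hv
    have hdis : Disjoint ν.support {y, j, x, k} := by
      rw [Finset.disjoint_right]
      intro v
      simp only [Finset.mem_insert, Finset.mem_singleton, Perm.mem_support, not_not]
      rintro (rfl | rfl | rfl | rfl) <;> assumption
    have h4 : ({y, j, x, k} : Finset α).card = 4 := by
      rw [Finset.card_eq_of_equiv_fin]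
      have : ({y, j, x, k} : Finset α) = ([y, j, x, k] : List α).toFinset := by ext; simp
      rw [this]
      exact (Finset.equivFinOfCardEq (by
        rw [List.toFinset_card_of_nodup]
        · rfl
        · simp [hyj.symm, hxy.symm, hky.symm, hjx, hjk, hxk.symm]))
    have := Finset.card_le_card hsub
    rw [Finset.card_union_of_disjoint hdis, h4] at this
    exact this.trans (List.toFinset_card_le L)
  have h5 := pc_euler (swap x k * (swap y j * (m :: L).formPerm)) _ ν hinv rfl
  have e : ν * (swap x k * (swap y j * (m :: L).formPerm)) = μ * (m :: L).formPerm := by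
    simp [hν, mul_assoc]
  rw [e] at h5
  omega
end PC
section PC
variable {α : Type*} [Fintype α] [DecidableEq α]

structure PCGood (m : α) (S A B : List α) (t : ℕ) (μ : Perm α) : Prop where
  inv : ∀ v, μ (μ v) = v
  supp : ∀ v, μ v ≠ v ↔ v ∈ S ∨ v ∈ A ∨ v ∈ B
  stk : ∀ v ∈ S, μ v ∉ S
  gen : 2 * cycleCount (μ * (m :: (S.reverse ++ A ++ B)).formPerm) +
    (S.length + A.length + B.length) = 2 * Fintype.card α
  stat : (Finset.univ.filter fun v => (v ∈ S ∨ v ∈ A) ∧ μ v ∈ B).card = t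

open Classical in
noncomputable def pcN (m : α) (S A B : List α) (t : ℕ) : ℕ :=
  (Finset.univ.filter fun μ : Perm α => PCGood m S A B t μ).card

def pcW : ℕ → ℕ → ℕ → ℕ
  | 0, h, t => if h = t then 1 else 0
  | a + 1, 0, t => pcW a 1 t
  | a + 1, h + 1, t => pcW a (h + 2) t + pcW a h t

theorem pc_push (m : α) (S A B : List α) (t : ℕ) (y : α) (μ : Perm α)
    (hnd : (m :: (S.reverse ++ (y :: A) ++ B)).Nodup) :
    (PCGood m S (y :: A) B t μ ∧ μ y ∉ S) ↔ PCGood m (y :: S) A B t μ := by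
  have hl : (y :: S).reverse ++ A ++ B = S.reverse ++ (y :: A) ++ B := by simp
  have hfil : (Finset.univ.filter fun v => (v ∈ S ∨ v ∈ y :: A) ∧ μ v ∈ B) =
      (Finset.univ.filter fun v => (v ∈ y :: S ∨ v ∈ A) ∧ μ v ∈ B) := by
    ext v; simp only [Finset.mem_filter, List.mem_cons]; tauto
  constructor
  · rintro ⟨⟨h1, h2, h3, h4, h5⟩, h6⟩
    refine ⟨h1, ?_, ?_, ?_, ?_⟩
    · intro v; rw [h2]; simp only [List.mem_cons]; tauto
    · intro v hv
      rw [List.mem_cons] at hv ⊢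
      push Not
      rcases hv with rfl | hv
      · exact ⟨(h2 v).2 (by simp), h6⟩
      · refine ⟨?_, h3 v hv⟩
        intro e
        apply h6; rw [← e, h1]; exact hv
    · rw [hl]; simp only [List.length_cons] at h4 ⊢; omega
    · rw [← hfil]; exact h5
  · rintro ⟨h1, h2, h3, h4, h5⟩
    refine ⟨⟨h1, ?_, ?_, ?_, ?_⟩, ?_⟩
    · intro v; rw [h2]; simp only [List.mem_cons]; tauto
    · intro v hv hc
      exact h3 v (by simp [hv]) (by simp [hc])
    · rw [hl] at h4; simp only [List.length_cons] at h4 ⊢; omega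
    · rw [hfil]; exact h5
    · intro hc
      exact h3 y (by simp) (by simp [hc])

theorem pc_del (ν : Perm α) (x y : α) (T : List α) (hT : T ≠ []) (hy : y ∉ T) (hνx : ν x = x) (hνy : ν y = y) :
    cycleCount (swap x y * ν * (x :: y :: T).formPerm) + 1 = cycleCount (ν * T.formPerm) := by
  rw [← pc_insert ν y T hT hy hνy, List.formPerm_cons_cons]
  have : swap x y * ν = ν * swap x y := by
    rw [mul_swap_eq_swap_mul, hνx, hνy]
  rw [this, mul_assoc, swap_mul_self_mul]

theorem pc_pair (m : α) (S A B : List α) (t : ℕ) (x y : α) (ν : Perm α)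
    (hnd : (m :: ((x :: S).reverse ++ (y :: A) ++ B)).Nodup) (hνx : ν x = x) (hνy : ν y = y) :
    PCGood m (x :: S) (y :: A) B t (swap x y * ν) ↔ PCGood m S A B t ν := by
  have hrot : (m :: ((x :: S).reverse ++ (y :: A) ++ B)) ~r x :: y :: (A ++ B ++ m :: S.reverse) := by
    have e1 : (m :: ((x :: S).reverse ++ (y :: A) ++ B)) = (m :: S.reverse) ++ (x :: y :: (A ++ B)) := by
      simp
    have e2 : x :: y :: (A ++ B ++ m :: S.reverse) = (x :: y :: (A ++ B)) ++ (m :: S.reverse) := by simp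
    rw [e1, e2]; exact List.isRotated_append
  have hnd2 := hrot.nodup_iff.1 hnd
  have hc := List.formPerm_eq_of_isRotated hnd hrot
  simp only [List.nodup_cons, List.mem_cons, not_or] at hnd2
  obtain ⟨⟨hxy, hxT⟩, hyT, hnT⟩ := hnd2
  have hrot2 : (A ++ B ++ m :: S.reverse) ~r (m :: (S.reverse ++ A ++ B)) := by
    have : (m :: (S.reverse ++ A ++ B)) = m :: S.reverse ++ (A ++ B) := by simp
    rw [this]; exact List.isRotated_append
  have hc2 := List.formPerm_eq_of_isRotated hnT hrot2
  have hcyc := pc_del ν x y _ (by simp) hyT hνx hνy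
  rw [← hc, hc2] at hcyc
  simp only [List.mem_append, List.mem_cons, List.mem_reverse, not_or] at hxT hyT
  obtain ⟨⟨hxA, hxB⟩, hxm, hxS⟩ := hxT
  obtain ⟨⟨hyA, hyB⟩, hym, hyS⟩ := hyT
  set μ := swap x y * ν with hμ
  have hμx : μ x = y := by simp [hμ, hνx]
  have hμy : μ y = x := by simp [hμ, hνy]
  have hνv : ∀ v, v ≠ x → v ≠ y → ν v ≠ x ∧ ν v ≠ y := fun v a b =>
    ⟨fun e => a (ν.injective (e.trans hνx.symm)), fun e => b (ν.injective (e.trans hνy.symm))⟩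
  have hμv : ∀ v, v ≠ x → v ≠ y → μ v = ν v := fun v a b => by
    rw [hμ, Perm.mul_apply, swap_apply_of_ne_of_ne (hνv v a b).1 (hνv v a b).2]
  have hfil : (Finset.univ.filter fun v => (v ∈ x :: S ∨ v ∈ y :: A) ∧ μ v ∈ B) =
      (Finset.univ.filter fun v => (v ∈ S ∨ v ∈ A) ∧ ν v ∈ B) := by
    ext v
    simp only [Finset.mem_filter, List.mem_cons, Finset.mem_univ, true_and]
    by_cases a : v = x
    · subst a; simp [hμx, hyB, hxS, hxA]
    by_cases b : v = y
    · subst b; simp [hμy, hxB, hyS, hyA]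
    rw [hμv v a b]; simp [a, b]
  constructor
  · rintro ⟨h1, h2, h3, h4, h5⟩
    refine ⟨?_, ?_, ?_, ?_, ?_⟩
    · intro v
      by_cases a : v = x
      · rw [a, hνx, hνx]
      by_cases b : v = y
      · rw [b, hνy, hνy]
      have := h1 v
      rwa [hμv v a b, hμv _ (hνv v a b).1 (hνv v a b).2] at this
    · intro v
      by_cases a : v = x
      · subst a; simp [hνx, hxS, hxA, hxB]
      by_cases b : v = y
      · subst b; simp [hνy, hyS, hyA, hyB]
      rw [← hμv v a b, h2]; simp [a, b]
    · intro v hv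
      have a : v ≠ x := fun e => hxS (e ▸ hv)
      have b : v ≠ y := fun e => hyS (e ▸ hv)
      have := h3 v (by simp [hv])
      rw [hμv v a b] at this
      simp at this; exact this.2
    · simp only [List.length_cons] at h4; omega
    · rw [← hfil]; exact h5
  · rintro ⟨h1, h2, h3, h4, h5⟩
    refine ⟨?_, ?_, ?_, ?_, ?_⟩
    · intro v
      by_cases a : v = x
      · rw [a, hμx, hμy]
      by_cases b : v = y
      · rw [b, hμy, hμx]
      rw [hμv v a b, hμv _ (hνv v a b).1 (hνv v a b).2, h1]
    · intro v
      by_cases a : v = x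
      · subst a; simp [hμx, Ne.symm hxy]
      by_cases b : v = y
      · subst b; simp [hμy, hxy]
      rw [hμv v a b, h2]; simp [a, b]
    · intro v hv
      rw [List.mem_cons] at hv
      rcases hv with rfl | hv
      · rw [hμx]; simp [hyS, Ne.symm hxy]
      · have a : v ≠ x := fun e => hxS (e ▸ hv)
        have b : v ≠ y := fun e => hyS (e ▸ hv)
        rw [hμv v a b]
        simp [(hνv v a b).1, h3 v hv]
    · simp only [List.length_cons]; omega
    · rw [hfil]; exact h5

theorem pc_top (m : α) (S A B : List α) (t : ℕ) (x y : α) (μ : Perm α)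
    (hnd : (m :: ((x :: S).reverse ++ (y :: A) ++ B)).Nodup)
    (h : PCGood m (x :: S) (y :: A) B t μ) (hy : μ y ∈ x :: S) : μ y = x := by
  by_contra hne
  have hyS : μ y ∈ S := by simpa [hne] using hy
  have e : (x :: S).reverse ++ (y :: A) ++ B = S.reverse ++ x :: y :: (A ++ B) := by simp
  obtain ⟨h1, h2, h3, h4, h5⟩ := h
  rw [e] at hnd h4
  refine pc_noncross μ h1 m x y S.reverse (A ++ B) hnd ?_ ?_ (by simpa using hyS) ?_
  · intro v hv
    rw [h2] at hv
    simp only [List.mem_cons, List.mem_append, List.mem_reverse] at hv ⊢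
    tauto
  · simp only [List.length_append, List.length_cons, List.length_reverse] at h4 ⊢; omega
  · have h6 : μ (μ x) ≠ μ x := by
      rw [h1]; exact ((h2 x).2 (by simp)).symm
    have h7 := (h2 _).1 h6
    have h8 := h3 x (by simp)
    have h9 : μ x ≠ y := fun e => hne (by rw [← e, h1])
    simp only [List.mem_cons, List.mem_append] at h7 h8 ⊢
    tauto

theorem pc_step_nil (m : α) (A B : List α) (t : ℕ) (y : α)
    (hnd : (m :: (([] : List α).reverse ++ (y :: A) ++ B)).Nodup) :
    pcN m [] (y :: A) B t = pcN m [y] A B t := by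
  unfold pcN
  congr 1
  ext μ
  simp only [Finset.mem_filter, Finset.mem_univ, true_and]
  rw [← pc_push m [] A B t y μ hnd]
  simp

theorem pc_step_cons (m : α) (S A B : List α) (t : ℕ) (x y : α)
    (hnd : (m :: ((x :: S).reverse ++ (y :: A) ++ B)).Nodup) :
    pcN m (x :: S) (y :: A) B t = pcN m (y :: x :: S) A B t + pcN m S A B t := by
  classical
  have hxS : x ∉ S ∧ x ∉ A ∧ x ∉ B ∧ y ∉ S ∧ y ∉ A ∧ y ∉ B := by
    simp [List.nodup_append] at hnd
    grind
  obtain ⟨a1, a2, a3, a4, a5, a6⟩ := hxS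
  unfold pcN
  rw [← Finset.card_filter_add_card_filter_not
    (s := Finset.univ.filter fun μ : Perm α => PCGood m (x :: S) (y :: A) B t μ) (fun μ => μ y ∉ x :: S)]
  congr 1
  · congr 1
    ext μ
    simp only [Finset.mem_filter, Finset.mem_univ, true_and]
    exact pc_push m (x :: S) A B t y μ hnd
  · refine Finset.card_nbij' (fun μ => swap x y * μ) (fun μ => swap x y * μ) ?_ ?_ ?_ ?_
    · intro μ hμ
      simp only [Finset.coe_filter, Finset.mem_filter, Finset.mem_univ, true_and, not_not, Set.mem_ofPred_eq] at hμ ⊢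
      obtain ⟨hg, hy⟩ := hμ
      have ht := pc_top m S A B t x y μ hnd hg hy
      have hx : μ x = y := by rw [← ht, hg.inv]
      rw [← pc_pair m S A B t x y _ hnd (by simp [hx]) (by simp [ht])]
      simpa using hg
    · intro ν hν
      simp only [Finset.coe_filter, Finset.mem_filter, Finset.mem_univ, true_and, not_not, Set.mem_ofPred_eq] at hν ⊢
      have f1 : ν x = x := by
        by_contra hc
        have := (hν.supp x).1 hc
        tauto
      have f2 : ν y = y := by
        by_contra hc
        have := (hν.supp y).1 hc
        tauto
      refine ⟨(pc_pair m S A B t x y ν hnd f1 f2).2 hν, ?_⟩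
      simp [f2]
    · intro μ _; simp
    · intro μ _; simp

theorem pc_no (m : α) (S : List α) (B : List α) (t : ℕ) (μ : Perm α) (h : PCGood m S [] B t μ)
    (v : α) (hv : v ∈ S) : μ v ∈ B := by
  have h6 : μ (μ v) ≠ μ v := by
    rw [h.inv]; exact ((h.supp v).2 (by simp [hv])).symm
  have h7 := (h.supp _).1 h6
  have h8 := h.stk v hv
  simp at h7; tauto

theorem pc_countC (m : α) (A : List α) : ∀ (S : List α), (m :: (S.reverse ++ A ++ [])).Nodup →
    pcN m S A [] 0 = pcW A.length S.length 0 := by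
  induction A with
  | nil =>
    intro S hnd
    cases S with
    | nil =>
      simp only [pcW, List.length_nil, if_true, pcN]
      rw [Finset.card_eq_one]
      refine ⟨1, ?_⟩
      ext μ
      simp only [Finset.mem_filter, Finset.mem_univ, true_and, Finset.mem_singleton]
      constructor
      · intro h
        ext v
        by_contra hc
        have := (h.supp v).1 (by simpa using hc)
        simp at this
      · rintro rfl
        refine ⟨?_, ?_, ?_, ?_, ?_⟩ <;> simp [pc_one]
    | cons x S =>
      simp only [pcW, List.length_nil, List.length_cons, pcN]
      rw [if_neg (by omega), Finset.card_eq_zero]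
      ext μ
      simp only [Finset.mem_filter, Finset.mem_univ, true_and, Finset.notMem_empty, iff_false]
      intro h
      have := pc_no m _ _ _ _ h x (by simp)
      simp at this
  | cons y A ih =>
    intro S hnd
    have hnd1 : (m :: ((y :: S).reverse ++ A ++ [])).Nodup := by simpa using hnd
    cases S with
    | nil => rw [pc_step_nil _ _ _ _ _ hnd, ih _ hnd1]; rfl
    | cons x S =>
      rw [pc_step_cons _ _ _ _ _ _ _ hnd, ih _ hnd1, ih S]
      · rfl
      · refine hnd.sublist ?_
        simp only [List.reverse_cons, List.append_assoc]
        refine List.Sublist.cons_cons _ (List.Sublist.append_left ?_ _)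
        simp

theorem pc_countM (m : α) (B : List α) (t : ℕ) (A : List α) :
    ∀ (S : List α), (m :: (S.reverse ++ A ++ B)).Nodup →
    pcN m S A B t = pcW A.length S.length t * pcW B.length t 0 := by
  induction A with
  | nil =>
    intro S hnd
    have hS : S.Nodup := by
      simp [List.nodup_append] at hnd; tauto
    have hfil : ∀ (μ : Perm α) , (∀ v ∈ S, μ v ∈ B) →
        (Finset.univ.filter fun v => (v ∈ S ∨ v ∈ ([] : List α)) ∧ μ v ∈ B).card = S.length := by
      intro μ hμ
      rw [← List.toFinset_card_of_nodup hS]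
      congr 1
      ext v
      simp only [Finset.mem_filter, Finset.mem_univ, true_and, List.mem_toFinset, List.not_mem_nil, or_false]
      exact ⟨fun h => h.1, fun h => ⟨h, hμ v h⟩⟩
    simp only [pcW, List.length_nil]
    split_ifs with hst
    · rw [one_mul, ← hst, ← pc_countC m B S (by simpa using hnd)]
      unfold pcN
      congr 1
      ext μ
      simp only [Finset.mem_filter, Finset.mem_univ, true_and]
      constructor
      · intro h
        refine ⟨h.inv, ?_, h.stk, ?_, ?_⟩
        · intro v; rw [h.supp]; simp
        · have := h.gen
          simpa using this
        · simp
      · intro h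
        refine ⟨h.inv, ?_, h.stk, ?_, ?_⟩
        · intro v; rw [h.supp]; simp
        · have := h.gen
          simpa using this
        · apply hfil
          intro v hv
          have h6 : μ (μ v) ≠ μ v := by
            rw [h.inv]; exact ((h.supp v).2 (by simp [hv])).symm
          have h7 := (h.supp _).1 h6
          have h8 := h.stk v hv
          simp at h7; tauto
    · rw [zero_mul]
      unfold pcN
      rw [Finset.card_eq_zero]
      ext μ
      simp only [Finset.mem_filter, Finset.mem_univ, true_and, Finset.notMem_empty, iff_false]
      intro h
      apply hst
      rw [← h.stat, hfil]
      exact pc_no m _ _ _ _ h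
  | cons y A ih =>
    intro S hnd
    have hnd1 : (m :: ((y :: S).reverse ++ A ++ B)).Nodup := by simpa using hnd
    cases S with
    | nil => rw [pc_step_nil _ _ _ _ _ hnd, ih _ hnd1]; rfl
    | cons x S =>
      rw [pc_step_cons _ _ _ _ _ _ _ hnd, ih _ hnd1, ih S]
      · rw [← add_mul]; rfl
      · refine hnd.sublist ?_
        simp only [List.reverse_cons, List.append_assoc]
        refine List.Sublist.cons_cons _ (List.Sublist.append_left ?_ _)
        simp
end PC

theorem pcW_fwd0 (a : ℕ) : ∀ h, pcW (a + 1) h 0 = pcW a h 1 := by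
  induction a with
  | zero => intro h; rcases h with _ | _ | h <;> simp [pcW]
  | succ a ih =>
    intro h
    cases h with
    | zero => rw [pcW, ih, pcW]
    | succ h => rw [pcW, ih, ih, pcW]

theorem pcW_fwd (a : ℕ) : ∀ h t, pcW (a + 1) h (t + 1) = pcW a h (t + 2) + pcW a h t := by
  induction a with
  | zero =>
    intro h t
    rcases h with _ | h
    · rcases t with _ | t <;> simp [pcW]
    · simp only [pcW]; split_ifs <;> omega
  | succ a ih =>
    intro h t
    cases h with
    | zero => rw [pcW, ih, pcW, pcW]
    | succ h => rw [pcW, ih, ih, pcW, pcW]; omega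

theorem pcW_symm (a : ℕ) : ∀ h t, pcW a h t = pcW a t h := by
  induction a with
  | zero => intro h t; simp [pcW, eq_comm]
  | succ a ih =>
    intro h t
    cases h with
    | zero => rw [pcW_fwd0, pcW, ih]
    | succ h => rw [pcW_fwd, pcW, ih, ih h]

theorem pcW_zero (a : ℕ) : ∀ t, a < t → pcW a t 0 = 0 := by
  induction a with
  | zero => intro t h; simp [pcW]; omega
  | succ a ih =>
    intro t h
    cases t with
    | zero => omega
    | succ t => rw [pcW, ih _ (by omega), ih _ (by omega)]

/-- ballot -/
theorem pcW_ballot (k : ℕ) : ∀ t, pcW (2 * k + t) t 0 + (if k = 0 then 0 else (2 * k + t).choose (k - 1))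
    = (2 * k + t).choose k := by
  suffices H : ∀ N k t, N = 2 * k + t → pcW N t 0 + (if k = 0 then 0 else N.choose (k - 1)) = N.choose k from
    fun t => H _ k t rfl
  intro N
  induction N with
  | zero => intro k t h; obtain rfl : k = 0 := by omega
            obtain rfl : t = 0 := by omega
            simp [pcW]
  | succ N ih =>
    intro k t h
    rcases t with _ | t
    · -- t = 0
      obtain ⟨k, rfl⟩ : ∃ k', k = k' + 1 := ⟨k - 1, by omega⟩
      have := ih k 1 (by omega)
      rw [pcW, if_neg (by omega), Nat.add_sub_cancel, Nat.choose_succ_succ']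
      have e : N.choose (k + 1) = N.choose k := by
        rw [← Nat.choose_symm_of_eq_add (n := N) (a := k) (b := k + 1) (by omega)]
      rcases k with _ | k
      · simp at this ⊢; simp at e; omega
      · rw [if_neg (by omega), Nat.add_sub_cancel] at this
        rw [Nat.choose_succ_succ' N k]; omega
    · rw [pcW]
      have h1 := ih k t (by omega)
      rcases k with _ | k
      · rw [pcW_zero _ _ (by omega)]; simp at h1 ⊢; omega
      · have h2 := ih k (t + 2) (by omega)
        rw [if_neg (by omega), Nat.add_sub_cancel] at h1 ⊢
        rw [Nat.choose_succ_succ' N k]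
        rcases k with _ | k
        · simp at *; omega
        · rw [if_neg (by omega), Nat.add_sub_cancel] at h2
          rw [Nat.choose_succ_succ' N k]; omega

theorem pcW_main (k s : ℕ) :
    (2 * k + s + 1) * pcW (2 * k + s) s 0 = (s + 1) * (2 * k + s + 1).choose k := by
  have h := pcW_ballot k s
  rcases k with _ | k
  · simp at h ⊢; rw [h]; try ring
  · rw [if_neg (by omega), Nat.add_sub_cancel] at h
    set N := 2 * (k + 1) + s with hN
    have h1 := Nat.choose_succ_right_eq N k
    have h2 : (N + 1).choose (k + 1) = N.choose k + N.choose (k + 1) := Nat.choose_succ_succ' N k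
    have h3 : N - k = k + 2 + s := by omega
    rw [h3] at h1
    rw [h2]
    have hN' : (N : ℤ) = 2 * (k + 1) + s := by rw [hN]; push_cast; ring
    zify at h h1 ⊢
    have e : (pcW N s 0 : ℤ) = N.choose (k + 1) - N.choose k := by linarith
    rw [e, hN']
    linear_combination 2 * h1

section PD

theorem pd_rot {β : Type*} [DecidableEq β] (a : ℕ) (f : Fin (a + 1) → β) (hf : Function.Injective f)
    (i : Fin (a + 1)) :
    (f 0 :: (List.finRange a).map (fun i => f i.succ)).formPerm (f i) = f (i + 1) := by
  have e : f 0 :: (List.finRange a).map (fun i => f i.succ) = (List.finRange (a + 1)).map f := by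
    rw [List.finRange_succ]; simp [Function.comp_def]
  rw [e]
  have hnd : ((List.finRange (a + 1)).map f).Nodup := (List.nodup_finRange _).map hf
  have h := List.formPerm_apply_getElem _ hnd i.1 (by simp; omega)
  simp only [List.getElem_map, List.getElem_finRange, List.length_map, List.length_finRange] at h
  refine h.trans ?_
  congr 1
  ext
  simp [Fin.val_add]

variable (a b : ℕ)

def pdC : List (Fin (a + 1) ⊕ Fin (b + 1)) := (List.finRange a).map (fun i => Sum.inl i.succ)
def pdD : List (Fin (a + 1) ⊕ Fin (b + 1)) := (List.finRange b).map (fun i => Sum.inr i.succ)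

theorem pdC_mem (v) : v ∈ pdC a b ↔ v.isLeft ∧ v ≠ Sum.inl 0 := by
  rcases v with i | i
  · rcases Fin.eq_zero_or_eq_succ i with rfl | ⟨k, rfl⟩
    · simp [pdC, Fin.succ_ne_zero]
    · simp [pdC, Fin.succ_ne_zero]
  · simp [pdC]

theorem pdD_mem (v) : v ∈ pdD a b ↔ v.isRight ∧ v ≠ Sum.inr 0 := by
  rcases v with i | i
  · simp [pdD]
  · rcases Fin.eq_zero_or_eq_succ i with rfl | ⟨k, rfl⟩
    · simp [pdD, Fin.succ_ne_zero]
    · simp [pdD, Fin.succ_ne_zero]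

theorem pdC_nd : (pdC a b).Nodup := (List.nodup_finRange _).map (fun i j h => by simpa using h)
theorem pdD_nd : (pdD a b).Nodup := (List.nodup_finRange _).map (fun i j h => by simpa using h)

theorem pd_nd : ((Sum.inl 0 :: pdC a b) ++ Sum.inr 0 :: pdD a b).Nodup := by
  rw [List.nodup_append]
  refine ⟨?_, ?_, ?_⟩
  · rw [List.nodup_cons]; exact ⟨by simp [pdC_mem], pdC_nd a b⟩
  · rw [List.nodup_cons]; exact ⟨by simp [pdD_mem], pdD_nd a b⟩
  · intro x hx y hy
    simp only [List.mem_cons, pdC_mem, pdD_mem] at hx hy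
    rintro rfl
    rcases x with x | x <;> simp at hx hy

theorem pd_gamma : (Equiv.sumCongr (finRotate (a + 1)) (finRotate (b + 1)) : Perm (Fin (a + 1) ⊕ Fin (b + 1))) =
    (Sum.inl 0 :: pdC a b).formPerm * (Sum.inr 0 :: pdD a b).formPerm := by
  apply Perm.ext
  intro v
  rcases v with i | i
  · rw [Perm.mul_apply, List.formPerm_apply_of_notMem (l := Sum.inr 0 :: pdD a b)]
    · have := pd_rot a (fun i => (Sum.inl i : Fin (a + 1) ⊕ Fin (b + 1))) Sum.inl_injective i
      rw [pdC, this]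
      simp
    · simp [pdD_mem]
  · rw [Perm.mul_apply]
    have := pd_rot b (fun i => (Sum.inr i : Fin (a + 1) ⊕ Fin (b + 1))) Sum.inr_injective i
    rw [pdD, this, List.formPerm_apply_of_notMem]
    · simp
    · simp [pdC_mem]

def PDY (s n : ℕ) (μ : Perm (Fin (a + 1) ⊕ Fin (b + 1))) : Prop :=
  (∀ v, μ (μ v) = v) ∧ (∀ v, μ v ≠ v) ∧
    (Finset.univ.filter fun i : Fin (a + 1) => (μ (Sum.inl i)).isRight).card = s ∧
    cycleCount (μ * (Equiv.sumCongr (finRotate (a + 1)) (finRotate (b + 1)))⁻¹) = n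

theorem pd_cyc {α : Type*} [Fintype α] [DecidableEq α] (μ γ : Perm α) (h : ∀ v, μ (μ v) = v) :
    cycleCount (μ * γ⁻¹) = cycleCount (μ * γ) := by
  have : μ⁻¹ = μ := by
    rw [inv_eq_iff_mul_eq_one]; exact Perm.ext h
  rw [← pc_inverse, mul_inv_rev, inv_inv, this, pc_comm]

theorem pd_red (t n : ℕ) (hn : a + 1 + (b + 1) = 2 * n) (ν : Perm (Fin (a + 1) ⊕ Fin (b + 1)))
    (hm : ν (Sum.inl 0) = Sum.inl 0) (hz : ν (Sum.inr 0) = Sum.inr 0) :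
    PDY a b (t + 1) n (swap (Sum.inl 0) (Sum.inr 0) * ν) ↔
      PCGood (Sum.inl 0) [] (pdC a b) (pdD a b) t ν := by
  set m : Fin (a + 1) ⊕ Fin (b + 1) := Sum.inl 0 with hmd
  set z : Fin (a + 1) ⊕ Fin (b + 1) := Sum.inr 0 with hzd
  have hmz : m ≠ z := by simp [hmd, hzd]
  set μ := swap m z * ν with hμ
  have hμm : μ m = z := by simp [hμ, hm]
  have hμz : μ z = m := by simp [hμ, hz]
  have hνv : ∀ v, v ≠ m → v ≠ z → ν v ≠ m ∧ ν v ≠ z := fun v h1 h2 =>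
    ⟨fun e => h1 (ν.injective (e.trans hm.symm)), fun e => h2 (ν.injective (e.trans hz.symm))⟩
  have hμv : ∀ v, v ≠ m → v ≠ z → μ v = ν v := fun v h1 h2 => by
    rw [hμ, Perm.mul_apply, swap_apply_of_ne_of_ne (hνv v h1 h2).1 (hνv v h1 h2).2]
  have hmem : ∀ v, (v ∈ pdC a b ∨ v ∈ pdD a b) ↔ v ≠ m ∧ v ≠ z := by
    intro v; rw [pdC_mem, pdD_mem]; rcases v with v | v <;> simp [hmd, hzd]
  -- involutivity
  have hinv : (∀ v, μ (μ v) = v) ↔ ∀ v, ν (ν v) = v := by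
    refine forall_congr' fun v => ?_
    by_cases h1 : v = m
    · rw [h1, hμm, hμz, hm, hm]
    by_cases h2 : v = z
    · rw [h2, hμz, hμm, hz, hz]
    rw [hμv v h1 h2, hμv _ (hνv v h1 h2).1 (hνv v h1 h2).2]
  have hfpf : (∀ v, μ v ≠ v) ↔ ∀ v, ν v ≠ v ↔ v ∈ ([] : List (Fin (a + 1) ⊕ Fin (b + 1))) ∨ v ∈ pdC a b ∨ v ∈ pdD a b := by
    refine forall_congr' fun v => ?_
    rw [hmem]
    by_cases h1 : v = m
    · rw [h1, hμm, hm]; simp [hmz.symm]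
    by_cases h2 : v = z
    · rw [h2, hμz, hz]; simp [hmz]
    rw [hμv v h1 h2]; simp [h1, h2]
  classical
  have hstat : (Finset.univ.filter fun i : Fin (a + 1) => (μ (Sum.inl i)).isRight).card =
      (Finset.univ.filter fun v : Fin (a + 1) ⊕ Fin (b + 1) => (v ∈ ([] : List (Fin (a + 1) ⊕ Fin (b + 1))) ∨ v ∈ pdC a b) ∧ ν v ∈ pdD a b).card + 1 := by
    rw [← Finset.card_map ⟨Sum.inl, Sum.inl_injective⟩ (β := Fin (a + 1) ⊕ Fin (b + 1)),
      ← Finset.card_insert_of_notMem (a := m)]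
    · congr 1
      ext v
      simp only [Finset.mem_map, Finset.mem_filter, Finset.mem_univ, true_and, Finset.mem_insert,
        Function.Embedding.coeFn_mk, List.not_mem_nil, false_or, pdC_mem, pdD_mem]
      rw [← hmd, ← hzd]
      by_cases h1 : v = m
      · subst h1
        simp only [true_or, iff_true]
        exact ⟨0, by rw [← hmd, hμm]; rfl, rfl⟩
      rcases v with i | i
      · have h2 : (Sum.inl i : Fin (a + 1) ⊕ Fin (b + 1)) ≠ z := by simp [hzd]
        have h3 := hμv _ h1 h2
        have h4 := (hνv _ h1 h2).2
        simp [h1, h3, h4]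
      · simp [h1]
    · simp [pdC_mem, hmd]
  have hcyc : cycleCount (μ * Equiv.sumCongr (finRotate (a + 1)) (finRotate (b + 1))) + 1 =
      cycleCount (ν * (m :: (([] : List (Fin (a + 1) ⊕ Fin (b + 1))).reverse ++ pdC a b ++ pdD a b)).formPerm) := by
    have nd := pd_nd a b
    rw [← hmd, ← hzd] at nd
    rw [pd_gamma, ← hmd, ← hzd, ← pc_cut _ _ _ _ nd]
    have e1 : μ = ν * swap m z := by rw [hμ, mul_swap_eq_swap_mul, hm, hz]
    rw [e1, mul_assoc, swap_mul_self_mul]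
    have r1 : (m :: pdC a b ++ z :: pdD a b) ~r (z :: (pdD a b ++ m :: pdC a b)) := by
      have : (z :: (pdD a b ++ m :: pdC a b)) = (z :: pdD a b) ++ (m :: pdC a b) := by simp
      rw [this]; exact List.isRotated_append
    have nd2 := r1.nodup_iff.1 nd
    rw [List.formPerm_eq_of_isRotated nd r1, pc_insert _ _ _ (by simp) (List.nodup_cons.1 nd2).1 hz]
    have r2 : (pdD a b ++ m :: pdC a b) ~r (m :: pdC a b ++ pdD a b) := List.isRotated_append
    rw [List.formPerm_eq_of_isRotated (List.nodup_cons.1 nd2).2 r2]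
    rfl
  have hlen : (pdC a b).length = a ∧ (pdD a b).length = b := by simp [pdC, pdD]
  have hcard : Fintype.card (Fin (a + 1) ⊕ Fin (b + 1)) = a + 1 + (b + 1) := by simp
  constructor
  · rintro ⟨h1, h2, h3, h4⟩
    rw [pd_cyc _ _ h1] at h4
    refine ⟨hinv.1 h1, hfpf.1 h2, by simp, ?_, by
      convert Nat.succ_injective (hstat.symm.trans h3)⟩
    rw [← hcyc, hlen.1, hlen.2, hcard]
    simp only [List.length_nil]
    omega
  · rintro ⟨h1, h2, h3, h4, h5⟩
    have h1' := hinv.2 h1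
    refine ⟨h1', hfpf.2 h2, by
      rw [hstat]; congr 1; convert h5, ?_⟩
    rw [pd_cyc _ _ h1']
    rw [← hcyc, hlen.1, hlen.2, hcard] at h4
    simp only [List.length_nil] at h4
    omega

open Classical in
theorem pd_E00 (t n : ℕ) (hn : a + 1 + (b + 1) = 2 * n) :
    (Finset.univ.filter fun μ : Perm (Fin (a + 1) ⊕ Fin (b + 1)) =>
      PDY a b (t + 1) n μ ∧ μ (Sum.inl 0) = Sum.inr 0).card =
      pcN (Sum.inl 0) [] (pdC a b) (pdD a b) t := by
  unfold pcN
  refine Finset.card_nbij' (fun μ => swap (Sum.inl 0) (Sum.inr 0) * μ)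
    (fun μ => swap (Sum.inl 0) (Sum.inr 0) * μ) ?_ ?_ ?_ ?_
  · intro μ hμ
    simp only [Finset.coe_filter, Finset.mem_univ, true_and, Set.mem_ofPred_eq] at hμ ⊢
    obtain ⟨hY, h0⟩ := hμ
    have h1 : μ (Sum.inr 0) = Sum.inl 0 := by rw [← h0, hY.1]
    rw [← pd_red a b t n hn _ (by simp [h0]) (by simp [h1])]
    simpa using hY
  · intro ν hν
    simp only [Finset.coe_filter, Finset.mem_univ, true_and, Set.mem_ofPred_eq] at hν ⊢
    have f1 : ν (Sum.inl 0) = Sum.inl 0 := by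
      by_contra hc
      have := (hν.supp _).1 hc
      simp [pdC_mem, pdD_mem] at this
    have f2 : ν (Sum.inr 0) = Sum.inr 0 := by
      by_contra hc
      have := (hν.supp _).1 hc
      simp [pdC_mem, pdD_mem] at this
    exact ⟨(pd_red a b t n hn ν f1 f2).2 hν, by simp [f1]⟩
  · intro μ _; simp
  · intro μ _; simp

theorem pd_conj (s n : ℕ) (i : Fin (a + 1)) (j : Fin (b + 1)) (μ : Perm (Fin (a + 1) ⊕ Fin (b + 1)))
    (h : PDY a b s n μ) :
    PDY a b s n (Equiv.sumCongr (Equiv.addRight i) (Equiv.addRight j) * μ *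
      (Equiv.sumCongr (Equiv.addRight i) (Equiv.addRight j))⁻¹) := by
  set ρ : Perm (Fin (a + 1) ⊕ Fin (b + 1)) := Equiv.sumCongr (Equiv.addRight i) (Equiv.addRight j) with hρ
  set γ : Perm (Fin (a + 1) ⊕ Fin (b + 1)) := Equiv.sumCongr (finRotate (a + 1)) (finRotate (b + 1)) with hγ
  have hcomm : ρ * γ = γ * ρ := by
    apply Perm.ext
    rintro (v | v)
    · simp [hρ, hγ, add_right_comm]
    · simp [hρ, hγ, add_right_comm]
  obtain ⟨h1, h2, h3, h4⟩ := h
  refine ⟨?_, ?_, ?_, ?_⟩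
  · intro v; simp [h1]
  · intro v e
    apply h2 (ρ⁻¹ v)
    apply ρ.injective
    simpa using e
  · rw [← h3]
    refine Finset.card_nbij' (fun v => v - i) (fun v => v + i) ?_ ?_ ?_ ?_
    · intro v hv
      simp only [Finset.coe_filter, Finset.mem_univ, true_and, Set.mem_ofPred_eq] at hv ⊢
      have e : ρ⁻¹ (Sum.inl v) = Sum.inl (v - i) := by
        rw [Perm.inv_eq_iff_eq]; simp [hρ]
      simp only [Perm.mul_apply, e] at hv
      rcases hh : μ (Sum.inl (v - i)) with w | w
      · rw [hh] at hv; simp [hρ] at hv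
      · rfl
    · intro v hv
      simp only [Finset.coe_filter, Finset.mem_univ, true_and, Set.mem_ofPred_eq] at hv ⊢
      have e : ρ⁻¹ (Sum.inl (v + i)) = Sum.inl v := by
        rw [Perm.inv_eq_iff_eq]; simp [hρ]
      simp only [Perm.mul_apply, e]
      rcases hh : μ (Sum.inl v) with w | w
      · rw [hh] at hv; simp at hv
      · simp [hρ]
    · intro v _; simp
    · intro v _; simp
  · rw [← h4, ← pc_conj (μ * γ⁻¹) ρ]
    congr 1
    have : ρ⁻¹ * γ⁻¹ = γ⁻¹ * ρ⁻¹ := by rw [← mul_inv_rev, ← mul_inv_rev, hcomm]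
    simp only [mul_assoc]
    rw [← hγ, this]

open Classical in
theorem pd_Eij (s n : ℕ) (i : Fin (a + 1)) (j : Fin (b + 1)) :
    (Finset.univ.filter fun μ : Perm (Fin (a + 1) ⊕ Fin (b + 1)) =>
      PDY a b s n μ ∧ μ (Sum.inl i) = Sum.inr j).card =
    (Finset.univ.filter fun μ : Perm (Fin (a + 1) ⊕ Fin (b + 1)) =>
      PDY a b s n μ ∧ μ (Sum.inl 0) = Sum.inr 0).card := by
  have hρ' : (Equiv.sumCongr (Equiv.addRight (-i)) (Equiv.addRight (-j)) : Perm (Fin (a + 1) ⊕ Fin (b + 1)))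
      = (Equiv.sumCongr (Equiv.addRight i) (Equiv.addRight j) : Perm (Fin (a + 1) ⊕ Fin (b + 1)))⁻¹ := by
    rw [eq_inv_iff_mul_eq_one]
    apply Perm.ext
    rintro (v | v) <;> simp
  have k1 := pd_conj a b s n i j
  have k2 := pd_conj a b s n (-i) (-j)
  rw [hρ'] at k2
  set ρ : Perm (Fin (a + 1) ⊕ Fin (b + 1)) := Equiv.sumCongr (Equiv.addRight i) (Equiv.addRight j) with hρ
  have e1 : ρ (Sum.inl 0) = Sum.inl i := by simp [hρ]
  have e2 : ρ (Sum.inr 0) = Sum.inr j := by simp [hρ]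
  have e3 : ρ⁻¹ (Sum.inl i) = Sum.inl 0 := by rw [Perm.inv_eq_iff_eq, e1]
  have e4 : ρ⁻¹ (Sum.inr j) = Sum.inr 0 := by rw [Perm.inv_eq_iff_eq, e2]
  refine Finset.card_nbij' (fun μ => ρ⁻¹ * μ * ρ⁻¹⁻¹) (fun μ => ρ * μ * ρ⁻¹) ?_ ?_ ?_ ?_
  · intro μ hμ
    simp only [Finset.coe_filter, Finset.mem_univ, true_and, Set.mem_ofPred_eq] at hμ ⊢
    refine ⟨k2 _ hμ.1, ?_⟩
    rw [inv_inv, Perm.mul_apply, Perm.mul_apply, e1, hμ.2, e4]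
  · intro μ hμ
    simp only [Finset.coe_filter, Finset.mem_univ, true_and, Set.mem_ofPred_eq] at hμ ⊢
    refine ⟨k1 _ hμ.1, ?_⟩
    rw [Perm.mul_apply, Perm.mul_apply, e3, hμ.2, e2]
  · intro μ _; simp [mul_assoc]
  · intro μ _; simp [mul_assoc]

theorem pd_main (t n : ℕ) (hn : a + 1 + (b + 1) = 2 * n) :
    (t + 1) * annCount (a + 1) (b + 1) (t + 1) n =
      (a + 1) * (b + 1) * (pcW a t 0 * pcW b t 0) := by
  classical
  have hY : annCount (a + 1) (b + 1) (t + 1) n =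
      (Finset.univ.filter fun μ => PDY a b (t + 1) n μ).card := by
    unfold annCount
    rw [Nat.card_eq_fintype_card, Fintype.card_subtype]
    congr 1
    ext μ
    rw [Finset.mem_filter, Finset.mem_filter]
    rfl
  have hN : pcN (Sum.inl 0) [] (pdC a b) (pdD a b) t = pcW a t 0 * pcW b t 0 := by
    rw [pc_countM]
    · simp only [pdC, pdD, List.length_map, List.length_finRange, List.length_nil]
      rw [pcW_symm a 0 t]
    · refine (pd_nd a b).sublist ?_
      simp
  have hsum : (t + 1) * (Finset.univ.filter fun μ => PDY a b (t + 1) n μ).card =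
      ∑ i : Fin (a + 1), ∑ j : Fin (b + 1), (Finset.univ.filter fun μ : Perm (Fin (a + 1) ⊕ Fin (b + 1)) =>
      PDY a b (t + 1) n μ ∧ μ (Sum.inl i) = Sum.inr j).card := by
    have e1 : ∀ i j, (Finset.univ.filter fun μ : Perm (Fin (a + 1) ⊕ Fin (b + 1)) =>
      PDY a b (t + 1) n μ ∧ μ (Sum.inl i) = Sum.inr j).card =
      ∑ μ ∈ (Finset.univ.filter fun μ => PDY a b (t + 1) n μ), if μ (Sum.inl i) = Sum.inr j then 1 else 0 := by
      intro i j
      rw [← Finset.filter_filter, Finset.card_filter]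
    simp_rw [e1]
    have e2 : ∀ i : Fin (a + 1), (∑ j : Fin (b + 1), ∑ μ ∈ (Finset.univ.filter fun μ => PDY a b (t + 1) n μ),
        if μ (Sum.inl i) = Sum.inr j then 1 else 0) =
        ∑ μ ∈ (Finset.univ.filter fun μ => PDY a b (t + 1) n μ), if (μ (Sum.inl i)).isRight then 1 else 0 := by
      intro i
      rw [Finset.sum_comm]
      refine Finset.sum_congr rfl fun μ _ => ?_
      rcases μ (Sum.inl i) with w | w <;> simp
    simp_rw [e2]
    rw [Finset.sum_comm]
    rw [mul_comm, ← smul_eq_mul, ← Finset.sum_const]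
    refine Finset.sum_congr rfl fun μ hμ => ?_
    have := (Finset.mem_filter.1 hμ).2.2.2.1
    rw [Finset.card_filter] at this
    exact this.symm
  rw [hY, hsum]
  simp_rw [pd_Eij a b (t + 1) n, pd_E00 a b t n hn, hN]
  simp [mul_assoc]

end PD

theorem planar_count (p q s n : ℕ) (hp : 1 ≤ p) (hq : 1 ≤ q) (hs : 1 ≤ s)
    (hps : p % 2 = s % 2) (hqs : q % 2 = s % 2) (hn : p + q = 2 * n) :
    (annCount p q s n : ℤ) =
      (s : ℤ) * ichoose (p : ℤ) (((p : ℤ) - s) / 2) *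
        ichoose (q : ℤ) (((q : ℤ) - s) / 2) := by
  obtain ⟨a, rfl⟩ : ∃ a, p = a + 1 := ⟨p - 1, by omega⟩
  obtain ⟨b, rfl⟩ : ∃ b, q = b + 1 := ⟨q - 1, by omega⟩
  obtain ⟨t, rfl⟩ : ∃ t, s = t + 1 := ⟨s - 1, by omega⟩
  have key : ∀ a : ℕ, (a + 1) % 2 = (t + 1) % 2 →
      ((a : ℤ) + 1) * (pcW a t 0 : ℤ) = (t + 1) * ichoose ((a + 1 : ℕ) : ℤ) ((((a + 1 : ℕ) : ℤ) - (t + 1 : ℕ)) / 2) := by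
    intro a ha
    by_cases h : t ≤ a
    · obtain ⟨k, rfl⟩ : ∃ k, a = 2 * k + t := ⟨(a - t) / 2, by omega⟩
      have e : (((2 * k + t + 1 : ℕ) : ℤ) - (t + 1 : ℕ)) / 2 = k := by omega
      rw [e, ichoose, if_pos (by omega)]
      have := pcW_main k t
      simp only [Int.toNat_natCast]
      exact_mod_cast this
    · rw [pcW_zero _ _ (by omega), ichoose, if_neg (by omega)]
      simp
  have h1 := key a hps
  have h2 := key b hqs
  have h3 := pd_main a b t n hn
  zify at h3
  have ht : ((t : ℤ) + 1) ≠ 0 := by positivity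
  apply mul_left_cancel₀ ht
  rw [h3]
  set X := ichoose ((a + 1 : ℕ) : ℤ) ((((a + 1 : ℕ) : ℤ) - (t + 1 : ℕ)) / 2)
  set Z := ichoose ((b + 1 : ℕ) : ℤ) ((((b + 1 : ℕ) : ℤ) - (t + 1 : ℕ)) / 2)
  push_cast
  calc _ = (((a : ℤ) + 1) * (pcW a t 0 : ℤ)) * (((b : ℤ) + 1) * (pcW b t 0 : ℤ)) := by ring
    _ = _ := by rw [h1, h2]; ring
end

section
/- Let n ≥ 1 be an integer. Then, as an identity of polynomials in x (equivalently, for every real number x), A_{n,n}(x) = n! Σ_{j=0}^{⌊(n−1)/2⌋} Σ_{i=0}^{n−2j−1} Σ_{k=0}^{⌊(n−2j−1)/2⌋} 4^{−k} · binom(2k,k) · binom(n,2k) · binom(2j,j) · binom(n−2j−1,i) · binom(x+j+i, n), where binom(x+j+i, n) = (x+j+i)(x+j+i−1)⋯(x+j+i−n+1)/n!. -/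
/-- The generalized binomial coefficient `binom(x, k) = x(x-1)⋯(x-k+1)/k!` for real `x`. -/
noncomputable def realChoose (x : ℝ) (k : ℕ) : ℝ :=
  (∏ t ∈ Finset.range k, (x - t)) / (Nat.factorial k)

/-- `annTotal p q k = a_{p,q,k}`: the number of pairings (fixed-point-free involutions)
`μ` of `[p] ∪ [q]'` with at least one mixed pair such that `μ ∘ γ_{p,q}⁻¹` has exactly
`k` cycles, where `γ_{p,q} = (1 2 … p)(1' 2' … q')`. -/
noncomputable def annTotal (p q k : ℕ) : ℕ :=
  Nat.card {μ : Equiv.Perm (Fin p ⊕ Fin q) //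
    (∀ v, μ (μ v) = v) ∧ (∀ v, μ v ≠ v) ∧
    (∃ i : Fin p, (μ (Sum.inl i)).isRight) ∧
    cycleCount (μ * (Equiv.sumCongr (finRotate p) (finRotate q))⁻¹) = k}



set_option linter.unusedSectionVars false
set_option linter.unusedSimpArgs false
namespace JK
open MvPolynomial

section Gauss
variable {σ : Type} [Fintype σ] [DecidableEq σ]

/-- Laplacian attached to an involution `s`. -/
noncomputable def lap (s : σ → σ) : MvPolynomial σ ℝ →ₗ[ℝ] MvPolynomial σ ℝ :=
  ∑ v, (pderiv v).toLinearMap ∘ₗ (pderiv (s v)).toLinearMap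

lemma lap_apply (s : σ → σ) (g : MvPolynomial σ ℝ) :
    lap s g = ∑ v, pderiv v (pderiv (s v) g) := by
  simp [lap]

lemma pd_comm (u v : σ) (g : MvPolynomial σ ℝ) :
    pderiv u (pderiv v g) = pderiv v (pderiv u g) := by
  have h : ⁅(pderiv u : Derivation ℝ (MvPolynomial σ ℝ) (MvPolynomial σ ℝ)),
      (pderiv v : Derivation ℝ (MvPolynomial σ ℝ) (MvPolynomial σ ℝ))⁆ = 0 := by
    apply MvPolynomial.derivation_ext
    intro i
    simp only [Derivation.commutator_apply, pderiv_X, Derivation.coe_zero, Pi.zero_apply]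
    by_cases h1 : u = i <;> by_cases h2 : v = i <;> simp [Pi.single_apply, h1, h2, eq_comm]
  have := congrArg (fun D => D g) h
  simp only [Derivation.commutator_apply, Derivation.coe_zero, Pi.zero_apply] at this
  exact sub_eq_zero.1 this

lemma lap_X_mul (s : σ → σ) (hs : ∀ v, s (s v) = v) (v : σ) (g : MvPolynomial σ ℝ) :
    lap s (X v * g) = X v * lap s g + 2 * pderiv (s v) g := by
  have key : ∀ u, pderiv u (pderiv (s u) (X v * g)) =
      X v * pderiv u (pderiv (s u) g) + ((if u = s v then pderiv u g else 0)
        + (if u = v then pderiv (s u) g else 0)) := by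
    intro u
    have e : (v = s u) ↔ (u = s v) := by
      constructor
      · rintro rfl; rw [hs]
      · rintro rfl; rw [hs]
    simp only [pderiv_mul, map_add, pderiv_X, Pi.single_apply, e, eq_comm (a := v) (b := u)]
    split_ifs <;> simp <;> ring
  rw [lap_apply, lap_apply, Finset.sum_congr rfl (fun u _ => key u), Finset.sum_add_distrib,
    Finset.sum_add_distrib, Finset.mul_sum]
  simp
  ring

lemma lap_pderiv (s : σ → σ) (v : σ) (g : MvPolynomial σ ℝ) :
    lap s (pderiv v g) = pderiv v (lap s g) := by
  simp only [lap_apply, map_sum]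
  refine Finset.sum_congr rfl fun u _ => ?_
  rw [pd_comm (s u) v, pd_comm u v]

lemma lap_pow_pderiv (s : σ → σ) (v : σ) (g : MvPolynomial σ ℝ) (k : ℕ) :
    (lap s ^ k) (pderiv v g) = pderiv v ((lap s ^ k) g) := by
  induction k with
  | zero => simp
  | succ k ih => rw [pow_succ', Module.End.mul_apply, ih, lap_pderiv, Module.End.mul_apply]

lemma lap_pow_X_mul (s : σ → σ) (hs : ∀ v, s (s v) = v) (v : σ) (g : MvPolynomial σ ℝ) (k : ℕ) :
    (lap s ^ (k+1)) (X v * g) = X v * (lap s ^ (k+1)) g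
      + (2 * (k+1) : ℝ) • (lap s ^ k) (pderiv (s v) g) := by
  induction k with
  | zero =>
    simp [lap_X_mul s hs]
    simp only [MvPolynomial.smul_eq_C_mul, map_ofNat]
  | succ k ih =>
    rw [pow_succ', Module.End.mul_apply, ih, map_add, lap_X_mul s hs, map_smul]
    rw [← lap_pow_pderiv, ← Module.End.mul_apply, ← Module.End.mul_apply, ← pow_succ', ← pow_succ']
    simp only [MvPolynomial.smul_eq_C_mul]
    push_cast
    simp only [map_mul, map_add, map_natCast, map_one, map_ofNat]
    ring

lemma coeff_zero_X_mul' (v : σ) (g : MvPolynomial σ ℝ) : coeff 0 (X v * g) = 0 := by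
  have : constantCoeff (X v * g) = 0 := by simp
  simpa [constantCoeff_eq] using this

lemma lap_nil (s : σ → σ) (hs : ∀ v, s (s v) = v) (g : MvPolynomial σ ℝ) :
    ∃ K, ∀ k, K ≤ k → (lap s ^ k) g = 0 := by
  induction g using MvPolynomial.induction_on with
  | C a =>
    refine ⟨1, fun k hk => ?_⟩
    obtain ⟨k, rfl⟩ := Nat.exists_eq_add_of_le' hk
    rw [pow_succ, Module.End.mul_apply, lap_apply]
    simp
  | add f g hf hg =>
    obtain ⟨K, hK⟩ := hf
    obtain ⟨M, hM⟩ := hg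
    refine ⟨max K M, fun k hk => ?_⟩
    rw [map_add, hK k (le_trans (le_max_left _ _) hk), hM k (le_trans (le_max_right _ _) hk), add_zero]
  | mul_X g v hg =>
    obtain ⟨K, hK⟩ := hg
    refine ⟨K+1, fun k hk => ?_⟩
    obtain ⟨k, rfl⟩ := Nat.exists_eq_add_of_le' (le_trans (Nat.le_add_left 1 K) hk)
    rw [mul_comm, lap_pow_X_mul s hs, lap_pow_pderiv, hK k (by omega), hK (k+1) (by omega)]
    simp

noncomputable def gterm (s : σ → σ) (k : ℕ) : MvPolynomial σ ℝ →ₗ[ℝ] ℝ :=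
  ((2 ^ k * (k.factorial : ℝ))⁻¹) • ((lcoeff ℝ (0 : σ →₀ ℕ)) ∘ₗ (lap s ^ k))

lemma gterm_fin (s : σ → σ) (hs : ∀ v, s (s v) = v) (g : MvPolynomial σ ℝ) :
    (Function.support fun k => gterm s k g).Finite := by
  obtain ⟨K, hK⟩ := lap_nil s hs g
  refine (Finset.range K).finite_toSet.subset fun k hk => ?_
  by_contra h
  simp only [Finset.coe_range, Set.mem_Iio, not_lt] at h
  apply hk
  simp [gterm, hK k h]

/-- existence of the Gaussian functional -/
theorem exists_gauss (s : σ → σ) (hs : ∀ v, s (s v) = v) :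
    ∃ E : MvPolynomial σ ℝ →ₗ[ℝ] ℝ, E 1 = 1 ∧
      ∀ v g, E (X v * g) = E (pderiv (s v) g) := by
  refine ⟨{ toFun := fun g => ∑ᶠ k, gterm s k g, map_add' := ?_, map_smul' := ?_ }, ?_, ?_⟩
  · intro f g
    simp only [map_add]
    exact finsum_add_distrib (gterm_fin s hs f) (gterm_fin s hs g)
  · intro c g
    simp only [map_smul, RingHom.id_apply]
    rw [smul_finsum' _ (gterm_fin s hs g)]
  · show ∑ᶠ k, gterm s k 1 = 1
    rw [finsum_eq_single _ 0]
    · simp [gterm]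
    · intro k hk
      obtain ⟨k, rfl⟩ := Nat.exists_eq_succ_of_ne_zero hk
      simp [gterm, pow_succ, Module.End.mul_apply, lap_apply]
  · intro v g
    show ∑ᶠ k, gterm s k (X v * g) = ∑ᶠ k, gterm s k (pderiv (s v) g)
    obtain ⟨K, hK⟩ := lap_nil s hs (pderiv (s v) g)
    obtain ⟨M, hM⟩ := lap_nil s hs (X v * g)
    have h1 : ∑ᶠ k, gterm s k (X v * g) = ∑ k ∈ Finset.range (max K M + 1), gterm s k (X v * g) := by
      apply finsum_eq_finsetSum_of_support_subset
      intro k hk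
      by_contra h
      simp only [Finset.coe_range, Set.mem_Iio, not_lt] at h
      apply hk
      simp [gterm, hM k (by have := le_max_right K M; omega)]
    have h2 : ∑ᶠ k, gterm s k (pderiv (s v) g)
        = ∑ k ∈ Finset.range (max K M), gterm s k (pderiv (s v) g) := by
      apply finsum_eq_finsetSum_of_support_subset
      intro k hk
      by_contra h
      simp only [Finset.coe_range, Set.mem_Iio, not_lt] at h
      apply hk
      simp [gterm, hK k (by have := le_max_left K M; omega)]
    rw [h1, h2, Finset.sum_range_succ']
    have h0 : gterm s 0 (X v * g) = 0 := by simp [gterm, coeff_zero_X_mul']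
    rw [h0, add_zero]
    refine Finset.sum_congr rfl fun k _ => ?_
    simp only [gterm, LinearMap.smul_apply, LinearMap.comp_apply, lap_pow_X_mul s hs, map_add,
      map_smul, lcoeff_apply, coeff_zero_X_mul', zero_add, smul_eq_mul, Nat.factorial_succ]
    have : (k.factorial : ℝ) ≠ 0 := by positivity
    push_cast
    field_simp
    ring

end Gauss
end JK

set_option linter.unusedSectionVars false
set_option linter.unusedSimpArgs false
namespace JK
open MvPolynomial

lemma pderiv_prod_X {σ α : Type} [DecidableEq σ] [DecidableEq α] (e : α → σ) (S : Finset α) (t : σ) :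
    pderiv t (∏ u ∈ S, (X (e u) : MvPolynomial σ ℝ)) =
      ∑ w ∈ S, if e w = t then ∏ u ∈ S.erase w, (X (e u) : MvPolynomial σ ℝ) else 0 := by
  induction S using Finset.induction_on with
  | empty => simp
  | insert a S ha ih =>
    rw [Finset.prod_insert ha, pderiv_mul, ih, Finset.sum_insert ha, Finset.erase_insert ha, Finset.mul_sum]
    congr 1
    · simp only [pderiv_X, Pi.single_apply]
      split_ifs <;> simp
    · refine Finset.sum_congr rfl fun w hw => ?_
      have hne : a ≠ w := by rintro rfl; exact ha hw
      rw [Finset.erase_insert_of_ne hne, Finset.prod_insert (by simp [ha])]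
      split_ifs <;> simp

open Classical in
/-- involutions whose support is `S` -/
noncomputable def invs {α : Type} [Fintype α] [DecidableEq α] (S : Finset α) : Finset (Equiv.Perm α) :=
  Finset.univ.filter fun μ => (∀ v, μ (μ v) = v) ∧ ∀ v, μ v ≠ v ↔ v ∈ S

open Classical in
theorem wick {σ : Type} [Fintype σ] [DecidableEq σ] (s : σ → σ) (hs : ∀ v, s (s v) = v)
    (E : MvPolynomial σ ℝ →ₗ[ℝ] ℝ) (hE1 : E 1 = 1) (hE : ∀ v g, E (X v * g) = E (pderiv (s v) g))
    {α : Type} [Fintype α] [DecidableEq α] (e : α → σ) (n : ℕ) : ∀ (S : Finset α), S.card ≤ n →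
    E (∏ u ∈ S, X (e u)) = ∑ μ ∈ invs S, if ∀ u ∈ S, e (μ u) = s (e u) then (1:ℝ) else 0 := by
  induction n with
  | zero =>
    intro S hS
    have : S = ∅ := by simpa using hS
    subst this
    have : invs (∅ : Finset α) = {1} := by
      ext μ
      simp only [invs, Finset.mem_filter, Finset.mem_univ, true_and, Finset.notMem_empty, iff_false,
        not_not, Finset.mem_singleton]
      constructor
      · rintro ⟨_, h⟩; ext v; simp [h v]
      · rintro rfl; simp
    simp [this, hE1]
  | succ n ih =>
    intro S hS
    rcases S.eq_empty_or_nonempty with rfl | ⟨v, hv⟩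
    · exact ih ∅ (by simp)
    obtain ⟨S, hvS, rfl⟩ : ∃ T, v ∉ T ∧ S = insert v T := ⟨S.erase v, by simp, by simp [hv]⟩
    rw [Finset.card_insert_of_notMem hvS] at hS
    rw [Finset.prod_insert hvS, hE, pderiv_prod_X, map_sum]
    have h1 : ∀ w ∈ S, E (if e w = s (e v) then ∏ u ∈ S.erase w, (X (e u) : MvPolynomial σ ℝ) else 0)
        = ∑ μ ∈ invs (S.erase w), if e w = s (e v) ∧ ∀ u ∈ S.erase w, e (μ u) = s (e u) then (1:ℝ) else 0 := by
      intro w hw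
      by_cases h : e w = s (e v)
      · simp only [h, if_true, true_and]
        exact ih _ (le_trans (Finset.card_erase_le) (by omega))
      · simp [h]
    rw [Finset.sum_congr rfl h1, Finset.sum_sigma']
    have hmem : ∀ (S : Finset α) (μ : Equiv.Perm α), μ ∈ invs S ↔
      ((∀ v, μ (μ v) = v) ∧ ∀ v, μ v ≠ v ↔ v ∈ S) := by intro S μ; simp [invs]
    have hfw : ∀ w ∈ S, ∀ μ ∈ invs (S.erase w), (μ v = v ∧ μ w = w ∧ (Equiv.swap v w * μ) v = w ∧
        (Equiv.swap v w * μ) w = v ∧ ∀ u, u ≠ v → u ≠ w → (Equiv.swap v w * μ) u = μ u ∧ μ u ≠ v ∧ μ u ≠ w) := by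
      intro w hw μ hμ
      rw [hmem] at hμ
      obtain ⟨hi, hsu⟩ := hμ
      have a1 : μ v = v := by
        by_contra h; have := (hsu v).1 h; simp [hvS] at this
      have a2 : μ w = w := by
        by_contra h; have := (hsu w).1 h; simp at this
      refine ⟨a1, a2, by simp [a1], by simp [a2], fun u hu1 hu2 => ?_⟩
      have b1 : μ u ≠ v := by
        intro h; apply hu1; rw [← a1] at h; exact μ.injective h
      have b2 : μ u ≠ w := by
        intro h; apply hu2; rw [← a2] at h; exact μ.injective h
      exact ⟨by rw [Equiv.Perm.mul_apply, Equiv.swap_apply_of_ne_of_ne b1 b2], b1, b2⟩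
    refine Finset.sum_bij' (fun x _ => Equiv.swap v x.1 * x.2)
      (fun μ _ => ⟨μ v, Equiv.swap v (μ v) * μ⟩) ?_ ?_ ?_ ?_ ?_
    · rintro ⟨w, μ⟩ hx
      simp only [Finset.mem_sigma] at hx
      obtain ⟨hw, hμ⟩ := hx
      have hvw : v ≠ w := by rintro rfl; exact hvS hw
      obtain ⟨a1, a2, a3, a4, a5⟩ := hfw w hw μ hμ
      rw [hmem] at hμ ⊢
      dsimp only
      constructor
      · intro u
        by_cases hu1 : u = v
        · rw [hu1, a3, a4]
        by_cases hu2 : u = w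
        · rw [hu2, a4, a3]
        obtain ⟨c1, c2, c3⟩ := a5 u hu1 hu2
        rw [c1, (a5 _ c2 c3).1, hμ.1]
      · intro u
        by_cases hu1 : u = v
        · rw [hu1, a3]; simp [hvw.symm]
        by_cases hu2 : u = w
        · rw [hu2, a4]; simp [hvw, hw]
        obtain ⟨c1, c2, c3⟩ := a5 u hu1 hu2
        rw [c1, hμ.2]; simp [hu1, hu2]
    · intro μ hμ
      rw [hmem] at hμ
      obtain ⟨hi, hsu⟩ := hμ
      have hv1 : μ v ≠ v := (hsu v).2 (by simp)
      have hv2 : μ v ∈ S := by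
        have : μ (μ v) ≠ μ v := by rw [hi]; exact hv1.symm
        have := (hsu _).1 this
        simpa [hv1] using this
      simp only [Finset.mem_sigma]
      refine ⟨hv2, ?_⟩
      rw [hmem]
      have b1 : (Equiv.swap v (μ v) * μ) v = v := by simp
      have b2 : (Equiv.swap v (μ v) * μ) (μ v) = μ v := by simp [hi]
      have b3 : ∀ u, u ≠ v → u ≠ μ v → (Equiv.swap v (μ v) * μ) u = μ u ∧ μ u ≠ v ∧ μ u ≠ μ v := by
        intro u h1 h2
        have c1 : μ u ≠ v := by intro h; apply h2; rw [← h, hi]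
        have c2 : μ u ≠ μ v := fun h => h1 (μ.injective h)
        exact ⟨by rw [Equiv.Perm.mul_apply, Equiv.swap_apply_of_ne_of_ne c1 c2], c1, c2⟩
      constructor
      · intro u
        by_cases hu1 : u = v
        · rw [hu1, b1, b1]
        by_cases hu2 : u = μ v
        · rw [hu2, b2, b2]
        obtain ⟨c1, c2, c3⟩ := b3 u hu1 hu2
        rw [c1, (b3 _ c2 c3).1, hi]
      · intro u
        by_cases hu1 : u = v
        · rw [hu1, b1]; simp [hvS]
        by_cases hu2 : u = μ v
        · rw [hu2, b2]; simp
        obtain ⟨c1, c2, c3⟩ := b3 u hu1 hu2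
        rw [c1, hsu]; simp [hu1, hu2]
    · rintro ⟨w, μ⟩ hx
      simp only [Finset.mem_sigma] at hx
      obtain ⟨hw, hμ⟩ := hx
      obtain ⟨a1, a2, a3, a4, a5⟩ := hfw w hw μ hμ
      simp only [a3]
      rw [← mul_assoc, Equiv.swap_mul_self, one_mul]
    · intro μ hμ
      simp only
      rw [← mul_assoc, Equiv.swap_mul_self, one_mul]
    · rintro ⟨w, μ⟩ hx
      simp only [Finset.mem_sigma] at hx
      obtain ⟨hw, hμ⟩ := hx
      have hvw : v ≠ w := by rintro rfl; exact hvS hw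
      obtain ⟨a1, a2, a3, a4, a5⟩ := hfw w hw μ hμ
      dsimp only
      congr 1
      apply propext
      constructor
      · rintro ⟨h1, h2⟩ u hu
        by_cases hu1 : u = v
        · rw [hu1, a3, h1]
        by_cases hu2 : u = w
        · rw [hu2, a4, h1, hs]
        rw [(a5 u hu1 hu2).1]
        exact h2 u (by simpa [hu1, hu2] using hu)
      · intro h
        refine ⟨by rw [← h v (by simp), a3], fun u hu => ?_⟩
        have hu' : u ≠ w ∧ u ∈ S := by simpa using hu
        have hu1 : u ≠ v := by rintro rfl; exact hvS hu'.2
        rw [← (a5 u hu1 hu'.1).1]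
        exact h u (by simp [hu'.2])

end JK

set_option linter.unusedSectionVars false
set_option linter.unusedSimpArgs false
namespace JK
open MvPolynomial

open Classical in
lemma card_inv_fun {α : Type} [Fintype α] (σ : Equiv.Perm α) (N : ℕ) :
    (Finset.univ.filter fun f : α → Fin N => ∀ v, f (σ v) = f v).card = N ^ cycleCount σ := by
  have e : {f : α → Fin N // ∀ v, f (σ v) = f v} ≃
      (Quotient (MulAction.orbitRel (Subgroup.zpowers σ) α) → Fin N) :=
    { toFun := fun f => Quotient.lift f.1 (by
        intro a b hab
        have hab : a ∈ MulAction.orbit (Subgroup.zpowers σ) b := hab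
        obtain ⟨⟨g, hg⟩, rfl⟩ := hab
        show f.1 (g b) = f.1 b
        have hf : ∀ v, f.1 (σ⁻¹ v) = f.1 v := by
          intro v
          have := f.2 (σ⁻¹ v)
          simpa using this.symm
        rw [Subgroup.mem_zpowers_iff] at hg
        obtain ⟨k, rfl⟩ := hg
        clear hab hg
        induction k using Int.induction_on generalizing b with
        | zero => simp
        | succ k ih => rw [zpow_add, zpow_one, Equiv.Perm.mul_apply, ih, f.2]
        | pred k ih => rw [zpow_sub, zpow_one, Equiv.Perm.mul_apply, ih, hf])
      invFun := fun h => ⟨fun v => h (Quotient.mk _ v), by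
        intro v
        apply congrArg h
        apply Quotient.sound
        show σ v ∈ MulAction.orbit (Subgroup.zpowers σ) v
        exact ⟨⟨σ, Subgroup.mem_zpowers σ⟩, rfl⟩⟩
      left_inv := by intro f; rfl
      right_inv := by
        intro h
        funext q
        induction q using Quotient.inductionOn
        rfl }
  rw [← Fintype.card_subtype, ← Nat.card_eq_fintype_card, Nat.card_congr e, Nat.card_fun, Nat.card_fin]
  rfl

lemma cycleCount_le {α : Type} [Fintype α] (σ : Equiv.Perm α) : cycleCount σ ≤ Fintype.card α := by
  rw [cycleCount, ← Nat.card_eq_fintype_card]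
  exact Nat.card_le_card_of_surjective (Quotient.mk _) Quotient.mk_surjective

lemma cycleCount_pos {α : Type} [Fintype α] [Nonempty α] (σ : Equiv.Perm α) : 1 ≤ cycleCount σ := by
  rw [cycleCount]
  have : Nonempty (Quotient (MulAction.orbitRel (Subgroup.zpowers σ) α)) :=
    ⟨Quotient.mk _ (Classical.arbitrary α)⟩
  exact Nat.card_pos

/-- number of colourings compatible with the pairing -/
noncomputable def col {α : Type} [Fintype α] [DecidableEq α] (N : ℕ) (γ μ : Equiv.Perm α) : ℝ :=
  ∑ f : α → Fin N, if ∀ u, f (μ u) = f (γ u) then (1:ℝ) else 0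

lemma col_eq {α : Type} [Fintype α] [DecidableEq α] (N : ℕ) (γ μ : Equiv.Perm α) :
    col N γ μ = (N:ℝ) ^ cycleCount (μ * γ⁻¹) := by
  classical
  have := card_inv_fun (μ * γ⁻¹) N
  rw [← Nat.cast_pow, ← this, col, Finset.sum_boole]
  congr 2
  ext f
  simp only [Finset.mem_filter, Finset.mem_univ, true_and]
  constructor
  · intro h v; have := h (γ⁻¹ v); simpa using this
  · intro h u; have := h (γ u); simpa using this

variable {N : ℕ}

abbrev Rg (N : ℕ) := MvPolynomial (Fin N × Fin N) ℝ

noncomputable def XM (N : ℕ) : Matrix (Fin N) (Fin N) (Rg N) := fun i j => X (i, j)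

theorem wick_col (E : Rg N →ₗ[ℝ] ℝ) (hE1 : E 1 = 1)
    (hE : ∀ v g, E (X v * g) = E (pderiv v.swap g))
    {α : Type} [Fintype α] [DecidableEq α] (γ : Equiv.Perm α) :
    ∑ μ ∈ invs (Finset.univ : Finset α), col N γ μ =
      E (∑ f : α → Fin N, ∏ u, XM N (f u) (f (γ u))) := by
  classical
  rw [map_sum]
  simp only [col]
  rw [Finset.sum_comm]
  refine Finset.sum_congr rfl fun f _ => ?_
  have := wick Prod.swap (fun v => Prod.swap_swap v) E hE1 hE (fun u => (f u, f (γ u)))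
    (Fintype.card α) Finset.univ le_rfl
  simp only [XM]
  rw [this]
  refine Finset.sum_congr rfl fun μ hμ => ?_
  have hi : ∀ v, μ (μ v) = v := by
    simp only [invs, Finset.mem_filter] at hμ; exact hμ.2.1
  congr 1
  simp only [Finset.mem_univ, true_implies, Prod.swap_prod_mk, Prod.mk.injEq, eq_iff_iff]
  constructor
  · intro h u
    refine ⟨h u, ?_⟩
    rw [← h (μ u), hi]
  · intro h u
    exact (h u).1

lemma pow_path {R ι : Type} [CommRing R] [Fintype ι] [DecidableEq ι] (M : Matrix ι ι R) (n : ℕ) :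
    ∀ a b, (M ^ (n+1)) a b = ∑ f : Fin n → ι,
      ∏ i : Fin (n+1), M (Fin.cons (α := fun _ => ι) a f i) (Fin.snoc (α := fun _ => ι) f b i) := by
  induction n with
  | zero =>
    intro a b
    simp [Fin.snoc]
  | succ n ih =>
    intro a b
    rw [pow_succ', Matrix.mul_apply]
    rw [← (Fin.consEquiv (fun _ : Fin (n+1) => ι)).sum_comp, Fintype.sum_prod_type]
    refine Finset.sum_congr rfl fun c _ => ?_
    rw [ih, Finset.mul_sum]
    refine Finset.sum_congr rfl fun f _ => ?_
    rw [Fin.prod_univ_succ (n := n + 1)]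
    have e : Fin.snoc (α := fun _ => ι) (Fin.cons (α := fun _ => ι) c f) b
        = Fin.cons (α := fun _ => ι) c (Fin.snoc (α := fun _ => ι) f b) :=
      (Fin.cons_snoc_eq_snoc_cons (β := ι) c f b).symm
    change _ = M a (Fin.snoc (α := fun _ => ι) (Fin.cons (α := fun _ => ι) c f) b 0) *
      ∏ i : Fin (n+1), M (Fin.cons (α := fun _ => ι) c f i)
        (Fin.snoc (α := fun _ => ι) (Fin.cons (α := fun _ => ι) c f) b i.succ)
    rw [e]
    rfl

lemma trace_pow {R ι : Type} [CommRing R] [Fintype ι] [DecidableEq ι] (M : Matrix ι ι R) (n : ℕ)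
    (hn : 1 ≤ n) : (M ^ n).trace = ∑ f : Fin n → ι, ∏ i, M (f i) (f (finRotate n i)) := by
  obtain ⟨n, rfl⟩ := Nat.exists_eq_add_of_le' hn
  rw [← (Fin.consEquiv (fun _ : Fin (n+1) => ι)).sum_comp, Fintype.sum_prod_type, Matrix.trace]
  refine Finset.sum_congr rfl fun a _ => ?_
  rw [Matrix.diag_apply, pow_path]
  refine Finset.sum_congr rfl fun f _ => ?_
  refine Finset.prod_congr rfl fun i _ => ?_
  simp only [Fin.consEquiv_apply]
  congr 1
  induction i using Fin.lastCases with
  | last => simp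
  | cast i => simp

lemma sum_sum_fun {R : Type} [CommRing R] {n m : ℕ} (M : Matrix (Fin N) (Fin N) R) (hn : 1 ≤ n) (hm : 1 ≤ m) :
    ∑ f : Fin n ⊕ Fin m → Fin N, ∏ u, M (f u) (f (Equiv.sumCongr (finRotate n) (finRotate m) u))
      = (M ^ n).trace * (M ^ m).trace := by
  rw [trace_pow M n hn, trace_pow M m hm, Finset.sum_mul_sum, ← Fintype.sum_prod_type',
    ← (Equiv.sumArrowEquivProdArrow _ _ _).symm.sum_comp]
  refine Finset.sum_congr rfl fun f _ => ?_
  rw [Fintype.prod_sum_type]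
  rfl

theorem ann_eq (n : ℕ) (hn : 1 ≤ n) (E : Rg N →ₗ[ℝ] ℝ) (hE1 : E 1 = 1)
    (hE : ∀ v g, E (X v * g) = E (pderiv v.swap g)) :
    ∑ k ∈ Finset.Icc 1 (2 * n), (annTotal n n k : ℝ) * (N:ℝ) ^ k =
      E ((XM N ^ n).trace * (XM N ^ n).trace) - E ((XM N ^ n).trace) ^ 2 := by
  classical
  set γ := Equiv.sumCongr (finRotate n) (finRotate n) with hγ
  have h1 := wick_col E hE1 hE γ
  rw [hγ, sum_sum_fun _ hn hn, ← hγ] at h1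
  have h2 := wick_col E hE1 hE (finRotate n)
  rw [← trace_pow _ _ hn] at h2
  rw [← h1, ← h2]
  rw [← Finset.sum_filter_add_sum_filter_not (invs (Finset.univ : Finset (Fin n ⊕ Fin n)))
    (fun μ => ∃ i : Fin n, (μ (Sum.inl i)).isRight)]
  have h3 : ∑ μ ∈ (invs (Finset.univ : Finset (Fin n ⊕ Fin n))).filter
      (fun μ => ¬ ∃ i : Fin n, (μ (Sum.inl i)).isRight), col N γ μ =
      (∑ μ ∈ invs (Finset.univ : Finset (Fin n)), col N (finRotate n) μ) ^ 2 := by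
    rw [sq, Finset.sum_mul_sum, ← Finset.sum_product']
    symm
    refine Finset.sum_bij (fun x _ => Equiv.sumCongr x.1 x.2) ?_ ?_ ?_ ?_
    · rintro ⟨μ, ν⟩ h
      simp only [invs, Finset.mem_product, Finset.mem_filter, Finset.mem_univ, true_and, iff_true] at h ⊢
      obtain ⟨⟨a1, a2⟩, ⟨b1, b2⟩⟩ := h
      refine ⟨⟨?_, ?_⟩, ?_⟩
      · rintro (v | v) <;> simp [a1, b1]
      · rintro (v | v) <;> simp [a2, b2]
      · rintro ⟨i, hi⟩; simp at hi
    · rintro ⟨μ, ν⟩ h ⟨μ', ν'⟩ h' heq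
      have := Equiv.Perm.sumCongrHom_injective (α := Fin n) (β := Fin n) heq
      exact this
    · intro μ hμ
      simp only [invs, Finset.mem_product, Finset.mem_filter, Finset.mem_univ, true_and, iff_true] at hμ
      obtain ⟨⟨a1, a2⟩, a3⟩ := hμ
      have : μ ∈ (Equiv.Perm.sumCongrHom (Fin n) (Fin n)).range := by
        apply Equiv.Perm.mem_sumCongrHom_range_of_perm_mapsTo_inl
        rintro _ ⟨i, rfl⟩
        push Not at a3
        have := a3 i
        rcases h : μ (Sum.inl i) with j | j
        · exact ⟨j, rfl⟩
        · rw [h] at this; simp at this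
      obtain ⟨⟨x, y⟩, rfl⟩ := this
      refine ⟨(x, y), ?_, rfl⟩
      simp only [invs, Finset.mem_product, Finset.mem_filter, Finset.mem_univ, true_and, iff_true]
      refine ⟨⟨fun v => ?_, fun v => ?_⟩, ⟨fun v => ?_, fun v => ?_⟩⟩
      · simpa using a1 (Sum.inl v)
      · simpa using a2 (Sum.inl v)
      · simpa using a1 (Sum.inr v)
      · simpa using a2 (Sum.inr v)
    · rintro ⟨μ, ν⟩ h
      simp only [col]
      rw [Finset.sum_mul_sum, ← Fintype.sum_prod_type',
        ← (Equiv.sumArrowEquivProdArrow _ _ _).symm.sum_comp]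
      refine Finset.sum_congr rfl fun f _ => ?_
      simp only [Sum.forall, hγ]
      rw [ite_zero_mul_ite_zero, mul_one]
      congr 1
  rw [h3, add_sub_cancel_right]
  have h4 : ∀ k, (annTotal n n k : ℝ) * (N:ℝ)^k = ∑ μ ∈ ((invs (Finset.univ : Finset (Fin n ⊕ Fin n))).filter
      (fun μ => ∃ i : Fin n, (μ (Sum.inl i)).isRight)).filter (fun μ => cycleCount (μ * γ⁻¹) = k), col N γ μ := by
    intro k
    rw [Finset.sum_congr rfl (g := fun _ => (N:ℝ)^k)]
    · rw [Finset.sum_const, nsmul_eq_mul]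
      congr 2
      rw [annTotal, Nat.card_eq_fintype_card, Fintype.card_subtype]
      congr 1
      ext μ
      simp only [invs, Finset.mem_filter, Finset.mem_univ, true_and, iff_true, hγ]
      tauto
    · intro μ hμ
      rw [col_eq, (Finset.mem_filter.1 hμ).2]
  rw [Finset.sum_congr rfl fun k _ => h4 k]
  apply Finset.sum_fiberwise_of_maps_to
  intro μ _
  rw [Finset.mem_Icc]
  have : Nonempty (Fin n ⊕ Fin n) := ⟨Sum.inl ⟨0, hn⟩⟩
  refine ⟨cycleCount_pos _, (cycleCount_le _).trans ?_⟩
  simp; omega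

end JK

set_option linter.unusedSectionVars false
set_option linter.unusedSimpArgs false
namespace JK
open MvPolynomial

section uniq
variable {A B : Type} [CommRing A] [Algebra ℝ A] [CommRing B] [Algebra ℝ B]

def PL (t : ℕ → A) (u : ℕ → B) (l : List ℕ) : A × B := ((l.map t).prod, (l.map u).prod)

def SL (t : ℕ → A) (u : ℕ → B) (m : ℕ) : Submodule ℝ (A × B) :=
  Submodule.span ℝ {x | ∃ l : List ℕ, l.sum ≤ m ∧ x = PL t u l}

lemma mem_SL (t : ℕ → A) (u : ℕ → B) {m : ℕ} (l : List ℕ) (h : l.sum ≤ m) : PL t u l ∈ SL t u m :=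
  Submodule.subset_span ⟨l, h, rfl⟩

lemma mul_SL (t : ℕ → A) (u : ℕ → B) {m : ℕ} (q : ℕ) (g : A × B) (h : g ∈ SL t u m) :
    (t q, u q) * g ∈ SL t u (q + m) := by
  induction h using Submodule.span_induction with
  | mem x hx =>
    obtain ⟨l, hl, rfl⟩ := hx
    have : (t q, u q) * PL t u l = PL t u (q :: l) := by simp [PL]
    rw [this]
    exact mem_SL t u _ (by simpa using hl)
  | zero => simp
  | add x y _ _ hx hy => rw [mul_add]; exact add_mem hx hy
  | smul a x _ hx => rw [mul_smul_comm]; exact Submodule.smul_mem _ _ hx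

lemma der_SL (t : ℕ → A) (u : ℕ → B) (p : ℕ) (D1 : Derivation ℝ A A) (D2 : Derivation ℝ B B)
    (h1 : ∀ q, D1 (t q) = (q : ℝ) • t (p + q - 1)) (h2 : ∀ q, D2 (u q) = (q:ℝ) • u (p + q - 1))
    (l : List ℕ) : (D1 (l.map t).prod, D2 (l.map u).prod) ∈ SL t u (p + l.sum) := by
  induction l with
  | nil =>
    simp only [List.map_nil, List.prod_nil, Derivation.map_one_eq_zero]
    exact Submodule.zero_mem _
  | cons q l ih =>
    have e : (D1 ((q :: l).map t).prod, D2 ((q :: l).map u).prod) =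
        (t q, u q) * (D1 (l.map t).prod, D2 (l.map u).prod) +
        (q:ℝ) • PL t u ((p + q - 1) :: l) := by
      simp only [List.map_cons, List.prod_cons, Derivation.leibniz, h1, h2, PL, smul_eq_mul]
      ext
      · simp [mul_comm]
      · simp [mul_comm]
    rw [e]
    apply add_mem
    · have := mul_SL t u q _ ih
      convert this using 2
      simp; ring
    · rcases Nat.eq_zero_or_pos q with rfl | hq
      · simp
      · apply Submodule.smul_mem
        apply mem_SL
        simp; omega

theorem uniq (t : ℕ → A) (u : ℕ → B) (D1 : ℕ → Derivation ℝ A A) (D2 : ℕ → Derivation ℝ B B)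
    (F1 : A →ₗ[ℝ] ℝ) (F2 : B →ₗ[ℝ] ℝ) (c : ℝ)
    (h1 : ∀ p q, D1 p (t q) = (q : ℝ) • t (p + q - 1)) (h2 : ∀ p q, D2 p (u q) = (q:ℝ) • u (p + q - 1))
    (t0 : t 0 = c • 1) (u0 : u 0 = c • 1) (hF : F1 1 = F2 1)
    (l1 : ∀ p g, F1 (t (p+1) * g) = F1 ((∑ a ∈ Finset.range p, t a * t (p-1-a)) * g + D1 p g))
    (l2 : ∀ p g, F2 (u (p+1) * g) = F2 ((∑ a ∈ Finset.range p, u a * u (p-1-a)) * g + D2 p g))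
    (m : ℕ) : ∀ l : List ℕ, l.sum ≤ m → F1 (l.map t).prod = F2 (l.map u).prod := by
  induction m using Nat.strong_induction_on with
  | _ m IH =>
    have key : ∀ m' < m, ∀ g ∈ SL t u m', F1 g.1 = F2 g.2 := by
      intro m' hm' g hg
      induction hg using Submodule.span_induction with
      | mem x hx =>
        obtain ⟨l, hl, rfl⟩ := hx
        exact IH m' hm' l hl
      | zero => simp
      | add x y _ _ hx hy => simp [hx, hy]
      | smul a x _ hx => simp [hx]
    intro l
    induction l with
    | nil => intro _; simpa using hF
    | cons p l ih =>
      intro hl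
      rw [List.sum_cons] at hl
      rcases p with _ | p
      · simp only [List.map_cons, List.prod_cons, t0, u0, smul_mul_assoc, one_mul, map_smul]
        rw [ih (by omega)]
      · simp only [List.map_cons, List.prod_cons]
        rw [l1, l2, map_add, map_add]
        congr 1
        · rw [Finset.sum_mul, Finset.sum_mul, map_sum, map_sum]
          refine Finset.sum_congr rfl fun a ha => ?_
          have := Finset.mem_range.1 ha
          have := IH (p - 1 + l.sum) (by omega) (a :: (p-1-a) :: l) (by simp; omega)
          simpa [mul_assoc] using this
        · exact key (p + l.sum) (by omega) _ (der_SL t u p (D1 p) (D2 p) (h1 p) (h2 p) l)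
end uniq

section mat
variable {N : ℕ}

lemma pderiv_XM_pow (i j : Fin N) (m : ℕ) : ∀ k l, pderiv (j, i) ((XM N ^ m) k l) =
    ∑ a ∈ Finset.range m, (XM N ^ a) k j * (XM N ^ (m-1-a)) i l := by
  induction m with
  | zero =>
    intro k l
    by_cases h : k = l <;> simp [h, Matrix.one_apply]
  | succ m ih =>
    intro k l
    rw [pow_succ', Matrix.mul_apply, map_sum]
    simp only [pderiv_mul, ih]
    rw [Finset.sum_add_distrib, Finset.sum_range_succ', add_comm]
    congr 1
    · simp only [Finset.mul_sum]
      rw [Finset.sum_comm]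
      refine Finset.sum_congr rfl fun a _ => ?_
      rw [pow_succ', Matrix.mul_apply, Finset.sum_mul]
      refine Finset.sum_congr rfl fun c _ => ?_
      rw [show m + 1 - 1 - (a + 1) = m - 1 - a by omega]
      ring
    · by_cases h : k = j
      · subst h
        simp only [XM, pderiv_X]
        rw [Finset.sum_eq_single i]
        · simp
        · intro b _ hb
          simp [Pi.single_apply, hb]
        · simp
      · simp only [XM, pderiv_X, pow_zero, Matrix.one_apply, h]
        simp [Pi.single_apply, h]

noncomputable def D1 (N p : ℕ) : Derivation ℝ (Rg N) (Rg N) :=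
  ∑ i, ∑ j, (XM N ^ p) j i • pderiv (j, i)

lemma D1_apply (p : ℕ) (g : Rg N) : D1 N p g = ∑ i, ∑ j, (XM N ^ p) j i * pderiv (j, i) g := by
  simp only [D1]
  rw [← Derivation.coeFnAddMonoidHom_apply]
  simp [map_sum, Finset.sum_apply]

lemma D1_tr (p q : ℕ) : D1 N p ((XM N ^ q).trace) = (q : ℝ) • (XM N ^ (p + q - 1)).trace := by
  rcases q with _ | q
  · have : (XM N ^ 0).trace = C (N:ℝ) := by simp [Matrix.trace]
    rw [this]; simp
  have h : ∀ i j, pderiv (j, i) ((XM N ^ (q+1)).trace) = (q+1 : ℝ) • (XM N ^ q) i j := by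
    intro i j
    rw [Matrix.trace, map_sum]
    simp only [Matrix.diag_apply, pderiv_XM_pow]
    rw [Finset.sum_comm]
    rw [Finset.sum_congr rfl (g := fun _ => (XM N ^ q) i j)]
    · simp [MvPolynomial.smul_eq_C_mul]
    · intro a ha
      have := Finset.mem_range.1 ha
      rw [show q = (q + 1 - 1 - a) + a by omega, pow_add, Matrix.mul_apply]
      refine Finset.sum_congr rfl fun k _ => ?_
      rw [show q + 1 - 1 - a + a + 1 - 1 - a = q - a by omega, show q + 1 - 1 - a = q - a by omega]
      ring
  rw [D1_apply]
  simp only [h]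
  rw [show p + (q + 1) - 1 = q + p by omega, pow_add, Matrix.trace, Finset.smul_sum]
  simp only [Matrix.diag_apply, Matrix.mul_apply, Finset.smul_sum]
  refine Finset.sum_congr rfl fun i _ => ?_
  refine Finset.sum_congr rfl fun j _ => ?_
  push_cast
  rw [mul_smul_comm, mul_comm]

lemma loop1 (E : Rg N →ₗ[ℝ] ℝ)
    (hE : ∀ v g, E (X v * g) = E (pderiv v.swap g)) (p : ℕ) (g : Rg N) :
    E ((XM N ^ (p+1)).trace * g) = E ((∑ a ∈ Finset.range p, (XM N ^ a).trace * (XM N ^ (p-1-a)).trace) * g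
      + D1 N p g) := by
  have e : (XM N ^ (p+1)).trace * g = ∑ i, ∑ j, X (i,j) * ((XM N ^ p) j i * g) := by
    rw [pow_succ', Matrix.trace, Finset.sum_mul]
    simp only [Matrix.diag_apply, Matrix.mul_apply, Finset.sum_mul, XM, mul_assoc]
  rw [e]
  simp only [map_sum, hE, Prod.swap_prod_mk]
  simp only [← map_sum]
  congr 1
  simp only [pderiv_mul, pderiv_XM_pow, Finset.sum_add_distrib]
  rw [D1_apply]
  congr 1
  simp only [Matrix.trace, Matrix.diag_apply, Finset.sum_mul_sum, Finset.sum_mul]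
  rw [Finset.sum_comm, Finset.sum_congr rfl fun j _ => Finset.sum_comm, Finset.sum_comm]
  refine Finset.sum_congr rfl fun a _ => ?_
  refine Finset.sum_congr rfl fun x _ => ?_
  rw [Finset.mul_sum, Finset.sum_mul]

end mat

section eig
variable {N : ℕ}
abbrev Rv (N : ℕ) := MvPolynomial (Fin N) ℝ

noncomputable def ps (N q : ℕ) : Rv N := ∑ i, X i ^ q

noncomputable def vd (N : ℕ) : Rv N := (Matrix.vandermonde (fun i : Fin N => (X i : Rv N))).det

noncomputable def D2 (N p : ℕ) : Derivation ℝ (Rv N) (Rv N) :=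
  ∑ i, (X i : Rv N) ^ p • pderiv i

lemma D2_apply (p : ℕ) (g : Rv N) : D2 N p g = ∑ i, X i ^ p * pderiv i g := by
  simp only [D2]
  rw [← Derivation.coeFnAddMonoidHom_apply]
  simp [map_sum, Finset.sum_apply]

lemma D2_X (p : ℕ) (i : Fin N) : D2 N p (X i) = X i ^ p := by
  rw [D2_apply]
  simp [pderiv_X, Pi.single_apply]

lemma D2_ps (p q : ℕ) : D2 N p (ps N q) = (q : ℝ) • ps N (p + q - 1) := by
  rcases q with _ | q
  · simp [ps]
  rw [ps, map_sum, ps, Finset.smul_sum]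
  refine Finset.sum_congr rfl fun i _ => ?_
  rw [Derivation.leibniz_pow, D2_X, show p + (q+1) - 1 = q + p by omega, pow_add]
  simp [MvPolynomial.smul_eq_C_mul]

lemma der_prod {R ι : Type} [CommRing R] [Algebra ℝ R] (D : Derivation ℝ R R) (S : Finset ι) (f h : ι → R)
    (H : ∀ i ∈ S, D (f i) = f i * h i) : D (∏ i ∈ S, f i) = (∏ i ∈ S, f i) * ∑ i ∈ S, h i := by
  classical
  induction S using Finset.induction_on with
  | empty => simp
  | insert a S ha ih =>
    rw [Finset.prod_insert ha, Finset.sum_insert ha, Derivation.leibniz,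
      ih fun i hi => H i (Finset.mem_insert_of_mem hi), H a (Finset.mem_insert_self _ _)]
    simp only [smul_eq_mul]; ring

noncomputable def hh (p : ℕ) (i j : Fin N) : Rv N := ∑ a ∈ Finset.range p, X i ^ a * X j ^ (p - 1 - a)

lemma hh_symm (p : ℕ) (i j : Fin N) : hh p i j = hh p j i := by
  unfold hh
  rw [← Finset.sum_range_reflect]
  refine Finset.sum_congr rfl fun a ha => ?_
  have := Finset.mem_range.1 ha
  rw [mul_comm, show p - 1 - (p - 1 - a) = a by omega]

lemma D2_vd (p : ℕ) : D2 N p (vd N) = vd N * ∑ i, ∑ j ∈ Finset.Ioi i, hh p i j := by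
  rw [vd, Matrix.det_vandermonde]
  apply der_prod
  intro i _
  apply der_prod
  intro j _
  rw [map_sub, D2_X, D2_X, hh_symm, hh, mul_comm]
  exact (Commute.all _ _).geom_sum₂_mul p |>.symm

lemma two_sum_hh (p : ℕ) : 2 * ∑ i, ∑ j ∈ Finset.Ioi i, (hh p i j : Rv N) =
    (∑ a ∈ Finset.range p, ps N a * ps N (p-1-a)) - p * ps N (p-1) := by
  have h1 : ∑ i, ∑ j, (hh p i j : Rv N) = ∑ a ∈ Finset.range p, ps N a * ps N (p-1-a) := by
    simp only [hh, ps, Finset.sum_mul_sum]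
    rw [Finset.sum_congr rfl fun j _ => Finset.sum_comm, Finset.sum_comm]
  have h2 : ∑ i, (hh p i i : Rv N) = p * ps N (p-1) := by
    simp only [ps, Finset.mul_sum]
    refine Finset.sum_congr rfl fun i _ => ?_
    rw [hh, Finset.sum_congr rfl (g := fun _ => X i ^ (p-1))]
    · simp
    · intro a ha
      have := Finset.mem_range.1 ha
      rw [← pow_add]; congr 1; omega
  have h3 : ∀ i, ∑ j, (hh p i j : Rv N) = ∑ j ∈ Finset.Ioi i, hh p i j + hh p i i + ∑ j ∈ Finset.Iio i, hh p i j := by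
    intro i
    have : (Finset.univ : Finset (Fin N)) = insert i (Finset.Ioi i ∪ Finset.Iio i) := by
      ext j; have := lt_trichotomy j i; simp only [Finset.mem_univ, Finset.mem_insert, Finset.mem_union, Finset.mem_Ioi, Finset.mem_Iio, true_iff]; tauto
    rw [this, Finset.sum_insert (by simp), Finset.sum_union]
    · ring
    · rw [Finset.disjoint_left]; intro j h1 h2; rw [Finset.mem_Ioi] at h1; rw [Finset.mem_Iio] at h2; exact lt_asymm h1 h2
  have h4 : ∑ i, ∑ j ∈ Finset.Iio i, (hh p i j : Rv N) = ∑ i, ∑ j ∈ Finset.Ioi i, (hh p i j : Rv N) := by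
    rw [Finset.sum_comm' (t' := Finset.univ) (s' := fun j => Finset.Ioi j)]
    · refine Finset.sum_congr rfl fun i _ => Finset.sum_congr rfl fun j _ => hh_symm _ _ _
    · intro x y; simp
  rw [← h1, ← h2, Finset.sum_congr rfl fun i _ => h3 i, Finset.sum_add_distrib, Finset.sum_add_distrib, h4]
  ring

lemma loop2 (L : Rv N →ₗ[ℝ] ℝ) (hL : ∀ v g, L (X v * g) = L (pderiv v g)) (p : ℕ) (g : Rv N) :
    L (ps N (p+1) * g * vd N ^ 2) = L (((∑ a ∈ Finset.range p, ps N a * ps N (p-1-a)) * g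
      + D2 N p g) * vd N ^ 2) := by
  have e : ps N (p+1) * g * vd N ^ 2 = ∑ i, X i * (X i ^ p * (g * vd N ^ 2)) := by
    rw [ps, Finset.sum_mul, Finset.sum_mul]
    refine Finset.sum_congr rfl fun i _ => ?_
    ring
  rw [e]
  simp only [map_sum, hL]
  simp only [← map_sum]
  congr 1
  have e2 : ∑ i, pderiv i (X i ^ p * (g * vd N ^ 2)) = (p : Rv N) * ps N (p-1) * (g * vd N ^ 2)
      + D2 N p (g * vd N ^ 2) := by
    rw [D2_apply, ps, Finset.mul_sum, Finset.sum_mul, ← Finset.sum_add_distrib]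
    refine Finset.sum_congr rfl fun i _ => ?_
    rw [pderiv_mul, pderiv_pow, pderiv_X_self]
    ring
  rw [e2, Derivation.leibniz, Derivation.leibniz_pow, D2_vd]
  have := two_sum_hh (N := N) p
  simp only [smul_eq_mul, nsmul_eq_mul]
  push_cast
  linear_combination (g * vd N ^ 2) * this
end eig

theorem mat_eig (N : ℕ) (E : Rg N →ₗ[ℝ] ℝ) (hE1 : E 1 = 1)
    (hE : ∀ v g, E (X v * g) = E (pderiv v.swap g))
    (L : Rv N →ₗ[ℝ] ℝ) (hL : ∀ v g, L (X v * g) = L (pderiv v g)) (l : List ℕ) :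
    L (vd N ^ 2) * E (l.map fun q => (XM N ^ q).trace).prod = L ((l.map (ps N)).prod * vd N ^ 2) := by
  have := uniq (fun q => (XM N ^ q).trace) (ps N) (D1 N) (D2 N) (L (vd N ^ 2) • E)
    (L ∘ₗ (LinearMap.mulRight ℝ (vd N ^ 2))) N D1_tr D2_ps
    (by simp [MvPolynomial.smul_eq_C_mul]) (by simp [ps, MvPolynomial.smul_eq_C_mul])
    (by simp [hE1])
    (by intro p g
        simp only [LinearMap.smul_apply]
        rw [loop1 E hE])
    (by intro p g
        simp only [LinearMap.comp_apply, LinearMap.mulRight_apply]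
        rw [loop2 L hL]) l.sum l le_rfl
  simpa using this

end JK

set_option linter.unusedSectionVars false
set_option linter.unusedSimpArgs false
namespace JK
open MvPolynomial

section one
lemma one_uniq (F : Polynomial ℝ →ₗ[ℝ] ℝ) (h : ∀ f, F (Polynomial.X * f) = F (Polynomial.derivative f))
    (h1 : F 1 = 0) (f : Polynomial ℝ) : F f = 0 := by
  have key : ∀ m : ℕ, F (Polynomial.X ^ m) = 0 := by
    intro m
    induction m using Nat.strong_induction_on with
    | _ m ih =>
      rcases m with _ | m
      · simpa using h1
      · rw [pow_succ', h, Polynomial.derivative_X_pow]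
        rcases m with _ | m
        · simp
        · have := ih m (by omega)
          rw [← Polynomial.smul_eq_C_mul, map_smul]
          simp [this]
  induction f using Polynomial.induction_on' with
  | add p q hp hq => rw [map_add, hp, hq, add_zero]
  | monomial n a => rw [← Polynomial.C_mul_X_pow_eq_monomial, ← Polynomial.smul_eq_C_mul, map_smul, key, smul_zero]

lemma exists_one : ∃ F : Polynomial ℝ →ₗ[ℝ] ℝ, F 1 = 1 ∧
    ∀ f, F (Polynomial.X * f) = F (Polynomial.derivative f) := by
  obtain ⟨E, h1, h2⟩ := exists_gauss (σ := Unit) id (fun _ => rfl)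
  refine ⟨E ∘ₗ (Polynomial.aeval (X () : MvPolynomial Unit ℝ)).toLinearMap, by simp [h1], ?_⟩
  intro f
  simp only [LinearMap.comp_apply, AlgHom.toLinearMap_apply, map_mul, Polynomial.aeval_X]
  rw [h2, Derivation.map_aeval]
  simp

noncomputable def He : ℕ → Polynomial ℝ
  | 0 => 1
  | n+1 => Polynomial.X * He n - Polynomial.derivative (He n)

lemma He_eq (n : ℕ) : He n = (Polynomial.hermite n).map (Int.castRingHom ℝ) := by
  induction n with
  | zero => simp [He]
  | succ n ih => simp [He, ih, Polynomial.hermite_succ, Polynomial.derivative_map]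

lemma He_monic (n : ℕ) : (He n).Monic := by
  rw [He_eq]; exact (Polynomial.hermite_monic n).map _

lemma He_deg (n : ℕ) : (He n).natDegree = n := by
  rw [He_eq, (Polynomial.hermite_monic n).natDegree_map, Polynomial.natDegree_hermite]

lemma He_der (n : ℕ) : Polynomial.derivative (He (n+1)) = Polynomial.C ((n:ℝ)+1) * He n := by
  induction n with
  | zero => simp [He]
  | succ n ih =>
    rw [He, Polynomial.derivative_sub, Polynomial.derivative_mul, ih, He]
    simp only [Polynomial.derivative_mul, Polynomial.derivative_C, Polynomial.derivative_X]
    push_cast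
    simp only [map_add, map_one]
    ring

lemma He_der' (n : ℕ) : Polynomial.derivative (He n) = Polynomial.C (n:ℝ) * He (n-1) := by
  cases n with
  | zero => simp [He]
  | succ n => rw [He_der]; simp

variable (F : Polynomial ℝ →ₗ[ℝ] ℝ) (F1 : F 1 = 1)
    (hF : ∀ f, F (Polynomial.X * f) = F (Polynomial.derivative f))
include hF
lemma F_He (i : ℕ) (f : Polynomial ℝ) : F (He (i+1) * f) = F (He i * Polynomial.derivative f) := by
  rw [He, sub_mul, mul_assoc, map_sub, hF, Polynomial.derivative_mul, map_add]
  ring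

include F1
lemma F_HeHe (i j : ℕ) : F (He i * He j) = if i = j then (j.factorial : ℝ) else 0 := by
  induction i generalizing j with
  | zero =>
    cases j with
    | zero => simp [He, F1]
    | succ j => rw [mul_comm, F_He F hF]; simp [He]
  | succ i ih =>
    rw [F_He F hF]
    cases j with
    | zero => simp [He]
    | succ j =>
      rw [He_der, mul_left_comm, ← Polynomial.smul_eq_C_mul, map_smul, ih]
      simp only [Nat.add_right_cancel_iff, Nat.factorial_succ]
      push_cast
      split_ifs <;> simp

omit hF F1
noncomputable def cc : ℕ → ℕ → ℕ → ℝ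
  | 0, i, j => if i = j then 1 else 0
  | p+1, i, j => cc p (i+1) j + i * cc p (i-1) j
include F1 hF

lemma F_cc (p i j : ℕ) : F (Polynomial.X ^ p * He i * He j) = j.factorial * cc p i j := by
  induction p generalizing i with
  | zero => rw [pow_zero, one_mul, F_HeHe F F1 hF]; simp [cc]
  | succ p ih =>
    have : Polynomial.X ^ (p+1) * He i * He j = Polynomial.X ^ p * He (i+1) * He j +
      (i:ℝ) • (Polynomial.X ^ p * He (i-1) * He j) := by
      rw [He, He_der', Polynomial.smul_eq_C_mul]; ring
    rw [this, map_add, map_smul, ih, ih, cc, smul_eq_mul]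
    ring
end one

section many
variable {N : ℕ} (L : Rv N →ₗ[ℝ] ℝ) (L1 : L 1 = 1) (hL : ∀ v g, L (X v * g) = L (pderiv v g))
  (F : Polynomial ℝ →ₗ[ℝ] ℝ) (F1 : F 1 = 1)
    (hF : ∀ f, F (Polynomial.X * f) = F (Polynomial.derivative f))
include hL F1 hF
lemma L_fac (j : Fin N) (g : Rv N) (hg : pderiv j g = 0) (f : Polynomial ℝ) :
    L (Polynomial.aeval (X j) f * g) = F f * L g := by
  have := one_uniq (L ∘ₗ (LinearMap.mulRight ℝ g) ∘ₗ (Polynomial.aeval (X j : Rv N)).toLinearMap - L g • F)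
    (by intro f
        simp only [LinearMap.sub_apply, LinearMap.comp_apply, AlgHom.toLinearMap_apply, map_mul,
          Polynomial.aeval_X, LinearMap.mulRight_apply, LinearMap.smul_apply, hF]
        rw [mul_assoc, hL, pderiv_mul, hg, Derivation.map_aeval]
        simp) (by simp [F1]) f
  simp only [LinearMap.sub_apply, LinearMap.comp_apply, AlgHom.toLinearMap_apply,
          LinearMap.mulRight_apply, LinearMap.smul_apply, smul_eq_mul] at this
  linarith

include L1
lemma L_prod (f : Fin N → Polynomial ℝ) (S : Finset (Fin N)) :
    L (∏ i ∈ S, Polynomial.aeval (X i) (f i)) = ∏ i ∈ S, F (f i) := by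
  induction S using Finset.induction_on with
  | empty => simp [L1]
  | insert a S ha ih =>
    rw [Finset.prod_insert ha, Finset.prod_insert ha, L_fac L hL F F1 hF, ih]
    rw [der_prod (pderiv a) S _ (fun _ => 0)]
    · simp
    · intro i hi
      have : a ≠ i := fun h => ha (h ▸ hi)
      rw [Derivation.map_aeval, pderiv_X_of_ne this.symm]
      simp

omit L1 hL F1 hF in
lemma vd_eq : vd N = (Matrix.of fun (i j : Fin N) => Polynomial.aeval (X i : Rv N) (He j)).det := by
  rw [vd, Matrix.det_eval_matrixOfPolynomials_eq_det_vandermonde _ (fun j : Fin N => (He j).map (algebraMap ℝ (Rv N)))]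
  · congr 1
    ext1 i j
    simp only [Matrix.of_apply]
    exact Polynomial.eval_map_algebraMap _ _
  · intro i; rw [(He_monic _).natDegree_map, He_deg]
  · intro i; exact (He_monic _).map _

lemma L_vd2 (e : Fin N → ℕ) : L ((∏ i, X i ^ e i) * vd N ^ 2) =
    ∑ s : Equiv.Perm (Fin N), (∏ b : Fin N, ((b:ℕ).factorial : ℝ)) *
      (Matrix.of fun a b : Fin N => cc (e (s a)) a b).det := by
  have h1 : (∏ i, X i ^ e i) * vd N ^ 2 = ∑ s : Equiv.Perm (Fin N), ∑ t : Equiv.Perm (Fin N),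
      ((Equiv.Perm.sign s : ℤ) * (Equiv.Perm.sign t : ℤ) : ℝ) •
        ∏ i, Polynomial.aeval (X i : Rv N) (Polynomial.X ^ e i * He (s i) * He (t i)) := by
    rw [sq, vd_eq, ← Matrix.det_transpose, Matrix.det_apply', Finset.sum_mul_sum, Finset.mul_sum]
    refine Finset.sum_congr rfl fun s _ => ?_
    rw [Finset.mul_sum]
    refine Finset.sum_congr rfl fun t _ => ?_
    simp only [map_mul, map_pow, Polynomial.aeval_X, Finset.prod_mul_distrib, Matrix.transpose_apply, Matrix.of_apply]
    rw [MvPolynomial.smul_eq_C_mul]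
    simp only [map_mul, map_intCast]
    ring
  rw [h1]
  simp only [map_sum, map_smul, L_prod L L1 hL F F1 hF, F_cc F F1 hF]
  rw [← Equiv.sum_comp (Equiv.inv (Equiv.Perm (Fin N)))]
  refine Finset.sum_congr rfl fun s _ => ?_
  rw [← Matrix.det_transpose, Matrix.det_apply', Finset.mul_sum, ← Equiv.sum_comp (Equiv.mulRight (s⁻¹))]
  refine Finset.sum_congr rfl fun t _ => ?_
  have hs : ∀ x, s⁻¹ (s x) = x := s.symm_apply_apply
  simp only [Equiv.inv_apply, Equiv.coe_mulRight, Matrix.transpose_apply, Matrix.of_apply, smul_eq_mul]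
  rw [← Equiv.prod_comp s]
  simp only [Equiv.Perm.coe_mul, Function.comp_apply, hs, Finset.prod_mul_distrib,
    Equiv.Perm.sign_mul, Equiv.Perm.sign_inv]
  rw [Equiv.prod_comp t (fun b : Fin N => ((b:ℕ).factorial : ℝ))]
  rcases Int.units_eq_one_or (Equiv.Perm.sign s) with h | h <;> rw [h] <;> push_cast <;> ring

omit L1 hL F1 hF in
lemma det_two (u v : Fin N → ℝ) (k l : Fin N) (h : k ≠ l) :
    (Matrix.of fun a b => if a = k then u b else if a = l then v b else if a = b then 1 else 0).det =
      u k * v l - u l * v k := by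
  have e : (Matrix.of fun a b => if a = k then u b else if a = l then v b else if a = b then (1:ℝ) else 0)
    = 1 + (Matrix.of fun (a : Fin N) (x : Fin 2) => if x = 0 then (if a = k then (1:ℝ) else 0) else if a = l then 1 else 0) *
      (Matrix.of fun (x : Fin 2) (b : Fin N) => if x = 0 then u b - (if k = b then 1 else 0) else v b - if l = b then 1 else 0) := by
    ext a b
    simp only [Matrix.of_apply, Matrix.add_apply, Matrix.mul_apply, Fin.sum_univ_two, Matrix.one_apply]
    by_cases h1 : a = k
    · subst h1; simp [h]
    · by_cases h2 : a = l
      · subst h2; simp [h1]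
      · simp [h1, h2]
  rw [e, Matrix.det_one_add_mul_comm, Matrix.det_fin_two]
  simp [Matrix.mul_apply, h, h.symm]

omit L1 hL F1 hF in
lemma det_one' (u : Fin N → ℝ) (k : Fin N) :
    (Matrix.of fun a b => if a = k then u b else if a = b then 1 else 0).det = u k := by
  have e : (Matrix.of fun a b => if a = k then u b else if a = b then (1:ℝ) else 0)
    = 1 + (Matrix.of fun (a : Fin N) (x : Fin 1) => (if a = k then (1:ℝ) else 0)) *
      (Matrix.of fun (x : Fin 1) (b : Fin N) => u b - (if k = b then 1 else 0)) := by
    ext a b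
    simp only [Matrix.of_apply, Matrix.add_apply, Matrix.mul_apply, Finset.univ_unique, Finset.sum_singleton, Matrix.one_apply]
    by_cases h1 : a = k
    · subst h1; simp
    · simp [h1]
  rw [e, Matrix.det_one_add_mul_comm, Matrix.det_fin_one]
  simp [Matrix.mul_apply]

def ex (p q : ℕ) (k l a : Fin N) : ℕ := (if a = k then p else 0) + if a = l then q else 0

omit L1 hL F1 hF in
lemma det_ex (p q : ℕ) (k l : Fin N) : (Matrix.of fun a b : Fin N => cc (ex p q k l a) a b).det =
    (if k = l then cc (p+q) k k else 0) + (cc p k k * cc q l l - cc p k l * cc q l k) := by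
  by_cases h : k = l
  · subst h
    rw [if_pos rfl, sub_self, add_zero, ← det_one' (fun b => cc (p+q) k b) k]
    congr 1; ext a b
    by_cases h1 : a = k
    · subst h1; simp [ex]
    · simp [ex, h1, cc, Fin.val_inj]
  · rw [if_neg h, zero_add, ← det_two (fun b => cc p k b) (fun b => cc q l b) k l h]
    congr 1; ext a b
    by_cases h1 : a = k
    · subst h1; simp [ex, h]
    · by_cases h2 : a = l
      · subst h2; simp [ex, h1]
      · simp [ex, h1, h2, cc, Fin.val_inj]

lemma L_ps (p q : ℕ) : L (ps N p * ps N q * vd N ^ 2) =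
    (N.factorial : ℝ) * (∏ b : Fin N, ((b:ℕ).factorial : ℝ)) *
     (∑ k : Fin N, cc (p+q) k k + (∑ k : Fin N, cc p k k) * (∑ l : Fin N, cc q l l)
      - ∑ k : Fin N, ∑ l : Fin N, cc p k l * cc q l k) := by
  have h1 : ps N p * ps N q * vd N ^ 2 = ∑ k, ∑ l, (∏ i, X i ^ ex p q k l i) * vd N ^ 2 := by
    rw [ps, ps, Finset.sum_mul_sum, Finset.sum_mul]
    refine Finset.sum_congr rfl fun k _ => ?_
    rw [Finset.sum_mul]
    refine Finset.sum_congr rfl fun l _ => ?_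
    congr 1
    simp only [ex, pow_add, Finset.prod_mul_distrib, pow_ite, pow_zero, Finset.prod_ite_eq', Finset.mem_univ, if_true]
  rw [h1]
  simp only [map_sum, L_vd2 L L1 hL F F1 hF]
  have h2 : ∀ (s : Equiv.Perm (Fin N)) (k l a : Fin N), ex p q (s k) (s l) (s a) = ex p q k l a := by
    intro s k l a; simp [ex]
  have h3 : ∀ s : Equiv.Perm (Fin N), ∑ k, ∑ l, (∏ b : Fin N, ((b:ℕ).factorial : ℝ)) *
      (Matrix.of fun a b : Fin N => cc (ex p q k l (s a)) a b).det =
      (∏ b : Fin N, ((b:ℕ).factorial : ℝ)) * ∑ k, ∑ l, (Matrix.of fun a b : Fin N => cc (ex p q k l a) a b).det := by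
    intro s
    rw [← Equiv.sum_comp s, Finset.mul_sum]
    refine Finset.sum_congr rfl fun k _ => ?_
    rw [← Equiv.sum_comp s, Finset.mul_sum]
    simp only [h2]
  rw [Finset.sum_congr rfl fun k _ => Finset.sum_comm, Finset.sum_comm, Finset.sum_congr rfl fun s _ => h3 s]
  simp only [det_ex, Finset.sum_const, Finset.card_univ, Fintype.card_perm, Fintype.card_fin, nsmul_eq_mul]
  rw [mul_assoc]
  congr 2
  simp [Finset.sum_add_distrib, Finset.sum_sub_distrib, Finset.sum_mul_sum]
  ring
end many

theorem mat_cc (N n : ℕ) (E : Rg N →ₗ[ℝ] ℝ) (hE1 : E 1 = 1)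
    (hE : ∀ v g, E (X v * g) = E (pderiv v.swap g)) :
    E ((XM N ^ n).trace * (XM N ^ n).trace) - E ((XM N ^ n).trace) ^ 2 =
    ∑ k : Fin N, cc (n+n) k k - ∑ k : Fin N, ∑ l : Fin N, cc n k l * cc n l k := by
  rcases Nat.eq_zero_or_pos N with rfl | hN
  · simp [Matrix.trace]
  have hN' : (N:ℝ) ≠ 0 := by exact_mod_cast hN.ne'
  obtain ⟨L, L1, hL⟩ := exists_gauss (σ := Fin N) id (fun _ => rfl)
  simp only [id] at hL
  obtain ⟨F, F1, hF⟩ := exists_one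
  have a0 := mat_eig N E hE1 hE L hL [0,0]
  have a1 := mat_eig N E hE1 hE L hL [n,0]
  have a2 := mat_eig N E hE1 hE L hL [n,n]
  simp only [List.map_cons, List.map_nil, List.prod_cons, List.prod_nil, mul_one,
    L_ps L L1 hL F F1 hF] at a0 a1 a2
  have t0 : (XM N ^ 0).trace = C (N:ℝ) := by simp
  have hC : ∀ g, E (g * C (N:ℝ)) = N * E g := by
    intro g; rw [mul_comm, ← MvPolynomial.smul_eq_C_mul, map_smul, smul_eq_mul]
  have hd : ∀ m, ∑ k : Fin N, ∑ l : Fin N, cc m k l * cc 0 l k = ∑ k : Fin N, cc m k k := by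
    intro m
    refine Finset.sum_congr rfl fun k _ => ?_
    simp [cc, ← Fin.ext_iff]
  have h0 : ∑ l : Fin N, cc 0 l l = N := by simp [cc]
  have hE0 : E (C (N:ℝ)) = N := by have := hC 1; rwa [one_mul, hE1, mul_one] at this
  rw [t0] at a0 a1
  rw [hC, hd, h0] at a0 a1
  rw [hE0] at a0
  set Z : ℝ := (N.factorial : ℝ) * (∏ b : Fin N, ((b:ℕ).factorial : ℝ))
  have hZ : Z ≠ 0 := by
    apply mul_ne_zero
    · exact_mod_cast N.factorial_ne_zero
    · exact Finset.prod_ne_zero_iff.2 fun b _ => by exact_mod_cast Nat.factorial_ne_zero _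
  have b0 : L (vd N ^ 2) = Z := by
    have : (L (vd N ^ 2) - Z) * (N * N) = 0 := by linear_combination a0
    rcases mul_eq_zero.1 this with h | h
    · linarith
    · simp [hN'] at h
  rw [b0] at a1 a2
  have b1 := mul_left_cancel₀ hZ a1
  have b2 := mul_left_cancel₀ hZ a2
  have b3 : E ((XM N ^ n).trace) = ∑ k : Fin N, cc n k k := by
    apply mul_left_cancel₀ hN'
    rw [b1]; simp; ring
  rw [b2, b3]; ring

end JK

set_option linter.unusedSectionVars false
set_option linter.unusedSimpArgs false
namespace JK
open MvPolynomial

lemma fne (n : ℕ) : (n.factorial : ℝ) ≠ 0 := by exact_mod_cast n.factorial_ne_zero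

lemma cc_symm (p i j : ℕ) : j.factorial * cc p i j = i.factorial * cc p j i := by
  obtain ⟨F, F1, hF⟩ := exists_one
  rw [← F_cc F F1 hF, ← F_cc F F1 hF, mul_right_comm]

lemma cc_left (p i j : ℕ) : cc (p+1) i j = cc p (i+1) j + i * cc p (i-1) j := by rw [cc]

abbrev PS := PowerSeries ℝ

lemma cc_right0 (p i : ℕ) : cc (p+1) i 0 = cc p i 1 := by
  have h1 := cc_symm (p+1) i 0
  have h2 := cc_symm p i 1
  rw [cc_left p 0] at h1
  simp at h1 h2
  linarith

lemma cc_rightS (p i j : ℕ) : cc (p+1) i (j+1) = cc p i j + (j+2) * cc p i (j+2) := by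
  have h1 := cc_symm (p+1) i (j+1)
  have h2 := cc_symm p i (j+2)
  have h3 := cc_symm p i j
  rw [cc_left p (j+1)] at h1
  simp only [Nat.factorial_succ, Nat.add_sub_cancel] at h1 h2
  push_cast at h1 h2
  have h4 : ((j:ℝ)+1) * j.factorial ≠ 0 := by
    have := fne j
    positivity
  apply mul_left_cancel₀ h4
  push_cast at h1
  linear_combination h1 - h2 - (j+1) * h3

lemma cc_I0 (p i : ℕ) : cc p (i+1) 0 = p * cc (p-1) i 0 ∧
    ∀ j, cc p (i+1) (j+1) = p * cc (p-1) i (j+1) + cc p i j := by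
  induction p with
  | zero => simp [cc]
  | succ p ih =>
    obtain ⟨h0, hs⟩ := ih
    constructor
    · rw [cc_right0, hs 0]
      rcases p with _ | p
      · simp [cc]
      · simp only [Nat.add_sub_cancel]
        rw [cc_right0 p i]; push_cast; ring
    · intro j
      rw [cc_rightS, hs (j+1)]
      rcases j with _ | j
      · rw [h0, cc_right0]
        rcases p with _ | p
        · simp [cc]; split_ifs <;> norm_num
        · simp only [Nat.add_sub_cancel]
          rw [cc_rightS p i]; push_cast; ring
      · rw [hs, cc_rightS p i]
        rcases p with _ | p
        · simp; ring
        · simp only [Nat.add_sub_cancel]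
          rw [cc_rightS p i]; push_cast; ring

lemma cc_J0 (p j : ℕ) : (j+1) * cc p 0 (j+1) = p * cc (p-1) 0 j := by
  have h := (cc_I0 p j).1
  have h1 := cc_symm p 0 (j+1)
  have h2 := cc_symm (p-1) 0 j
  rw [Nat.factorial_succ] at h1
  push_cast at h1
  apply mul_left_cancel₀ (fne j)
  rw [h] at h1
  linear_combination h1 - p * h2

lemma cc_JS (p i j : ℕ) : (j+1) * cc p (i+1) (j+1) = p * cc (p-1) (i+1) j + (i+1) * cc p i j := by
  have h := (cc_I0 p j).2 i
  have h1 := cc_symm p (i+1) (j+1)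
  have h2 := cc_symm (p-1) (i+1) j
  have h3 := cc_symm p i j
  simp only [Nat.factorial_succ] at h1 h2
  push_cast at h1 h2
  apply mul_left_cancel₀ (fne j)
  rw [h] at h1
  linear_combination h1 - p * h2 - (i+1) * h3

/-- auxiliary products -/
noncomputable def VV (p q i j : ℕ) : ℝ := cc p i j * cc q j i

lemma VV_symm (p q i j : ℕ) : VV p q i j = VV p q j i := by
  have h1 := cc_symm p i j
  have h2 := cc_symm q i j
  unfold VV
  apply mul_left_cancel₀ (mul_ne_zero (fne i) (fne j))
  linear_combination i.factorial * cc q j i * h1 - i.factorial * cc p j i * h2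

lemma VV_swap (p q i j : ℕ) : VV p q i j = VV q p i j := by
  rw [VV_symm]; unfold VV; ring

lemma VV_rec (p q i j : ℕ) : VV (p+1) q (i+1) (j+1) - VV (p+1) q i j =
    p * (VV (p-1) q (i+1) (j+1) + VV (p-1) q i j) +
    q * (VV p (q-1) i (j+1) + VV p (q-1) (i+1) j) := by
  unfold VV
  have a1 : cc (p+1) (i+1) (j+1) = cc p (i+1) j + p * cc (p-1) (i+1) (j+1) + (i+1) * cc p i (j+1) := by
    have := cc_JS p i (j+1)
    push_cast at this
    rw [cc_rightS]; linear_combination this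
  have a2 : cc (p+1) i j = cc p (i+1) j + (j+1) * cc p i (j+1) - p * cc (p-1) i j := by
    rw [cc]
    rcases i with _ | i
    · have := cc_J0 p j
      simp; linear_combination -this
    · have := cc_JS p i j
      simp; linear_combination -this
  have b1 := (cc_I0 q j).2 i
  have b2 := cc_JS q j i
  rw [a1, a2]
  linear_combination cc p (i+1) j * b1 + cc p i (j+1) * b2

lemma VV_bdS (p q i : ℕ) : VV (p+1) q (i+1) 0 = p * VV (p-1) q (i+1) 0 + q * VV p (q-1) i 0 := by
  unfold VV
  have a1 := cc_right0 p (i+1)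
  have a2 := cc_JS p i 0
  have a3 := cc_J0 q i
  push_cast at a2
  rw [a1]
  linear_combination cc q 0 (i+1) * a2 + cc p i 0 * a3

lemma VV_bd0 (p q : ℕ) : VV (p+1) q 0 0 = p * VV (p-1) q 0 0 := by
  unfold VV
  have a1 := cc_right0 p 0
  have a2 := cc_J0 p 0
  push_cast at a2
  rw [a1]
  linear_combination cc q 0 0 * a2

lemma cc_mul (p q i j K : ℕ) (h : i + p < K) : cc (p+q) i j = ∑ k ∈ Finset.range K, cc p i k * cc q k j := by
  induction p generalizing i with
  | zero => simp [cc, Finset.sum_ite_eq, show i < K by omega]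
  | succ p ih =>
    rw [show p + 1 + q = (p + q) + 1 by ring, cc, ih (i+1) (by omega), ih (i-1) (by omega), Finset.mul_sum,
      ← Finset.sum_add_distrib]
    refine Finset.sum_congr rfl fun k _ => ?_
    rw [cc]; ring

lemma cc_band (p i j : ℕ) (h : i + p < j) : cc p i j = 0 := by
  induction p generalizing i with
  | zero => simp [cc, show i ≠ j by omega]
  | succ p ih => rw [cc, ih _ (by omega), ih _ (by omega)]; simp

open PowerSeries in
noncomputable def GG (p q d : ℕ) : PowerSeries ℝ := PowerSeries.mk fun i => VV p q (i+d) i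

lemma GG_recS (p q d : ℕ) : (1 - PowerSeries.X) * GG (p+1) q (d+1) =
    (1 + PowerSeries.X) * ((p:PS) * GG (p-1) q (d+1)) + (q:PS) * (GG p (q-1) d + PowerSeries.X * GG p (q-1) (d+2)) := by
  have hn : ∀ (a m : ℕ) (f : PowerSeries ℝ), PowerSeries.coeff m ((a : PowerSeries ℝ) * f) = a * PowerSeries.coeff m f := by
    intro a m f
    rw [← map_natCast (PowerSeries.C (R := ℝ)), PowerSeries.coeff_C_mul]
  ext m
  simp only [sub_mul, add_mul, one_mul, map_sub, map_add, hn]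
  rcases m with _ | m
  · simp [PowerSeries.coeff_zero_X_mul, GG, hn, VV_bdS]
  · simp only [PowerSeries.coeff_succ_X_mul, GG, PowerSeries.coeff_mk, hn, map_add]
    have := VV_rec p q (m+(d+1)) m
    rw [show m + 1 + (d+1) = m + (d+1) + 1 by ring, show m + 1 + d = m + (d+1) by ring,
      show m + (d+2) = m + (d+1) + 1 by ring]
    linear_combination this

lemma GG_rec0 (p q : ℕ) : (1 - PowerSeries.X) * GG (p+1) q 0 =
    (1 + PowerSeries.X) * ((p:PS) * GG (p-1) q 0) + (q:PS) * (2 * (PowerSeries.X * GG p (q-1) 1)) := by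
  have hn : ∀ (a m : ℕ) (f : PowerSeries ℝ), PowerSeries.coeff m ((a : PowerSeries ℝ) * f) = a * PowerSeries.coeff m f := by
    intro a m f
    rw [← map_natCast (PowerSeries.C (R := ℝ)), PowerSeries.coeff_C_mul]
  have h2 : ∀ (f : PowerSeries ℝ), 2 * f = f + f := fun f => two_mul f
  ext m
  simp only [sub_mul, add_mul, one_mul, map_sub, map_add, hn, h2]
  rcases m with _ | m
  · simp [PowerSeries.coeff_zero_X_mul, GG, hn, VV_bd0]
  · simp only [PowerSeries.coeff_succ_X_mul, GG, PowerSeries.coeff_mk, hn, map_add]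
    have := VV_rec p q m m
    rw [VV_symm p (q-1) m (m+1)] at this
    simp only [add_zero]
    linear_combination this

/-- coefficient polynomials -/
noncomputable def al : ℕ → ℕ → ℕ → PowerSeries ℝ
  | 0, 0, s => if s = 0 then 1 else 0
  | 0, 1, _ => 0
  | 0, q+2, s => (1 + PowerSeries.X) * (((q+1 : ℕ) : PS) * al 0 q s)
  | 1, q, s => (q:PS) * (if s = 0 then 0 else al 0 (q-1) (s-1))
  | p+2, q, s => (1 + PowerSeries.X) * (((p+1 : ℕ):PS) * al p q s) + (q:PS) * (if s = 0 then 0 else al (p+1) (q-1) (s-1))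

lemma al_rec (p q s : ℕ) : al (p+1) q s = (1 + PowerSeries.X) * ((p:PS) * al (p-1) q s)
    + (q:PS) * (if s = 0 then 0 else al p (q-1) (s-1)) := by
  rcases p with _ | p
  · simp [al]
  · rw [al]; simp

lemma al_0 (q s : ℕ) (hs : s ≠ 0) : al 0 q s = 0 := by
  induction q using Nat.strong_induction_on with
  | _ q ih =>
    rcases q with _ | _ | q
    · simp [al, hs]
    · simp [al]
    · rw [al, ih q (by omega)]; simp

lemma al_zero (p q s : ℕ) (h : p < s) : al p q s = 0 := by
  induction p using Nat.strong_induction_on generalizing q s with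
  | _ p ih =>
    rcases p with _ | p
    · exact al_0 q s (by omega)
    · rw [al_rec, if_neg (by omega), ih p (by omega) _ _ (by omega), ih (p-1) (by omega) _ _ (by omega)]
      simp

noncomputable def TT (p q d M : ℕ) : PowerSeries ℝ :=
  ∑ m ∈ Finset.range M, al p q (d+2*m) * (((d+2*m).choose m : ℕ) : PS) * PowerSeries.X ^ m

lemma TT_recS (p q d M : ℕ) : TT (p+1) q (d+1) (M+1) = (1 + PowerSeries.X) * ((p:PS) * TT (p-1) q (d+1) (M+1)) +
    (q:PS) * (TT p (q-1) d (M+1) + PowerSeries.X * TT p (q-1) (d+2) M) := by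
  unfold TT
  have e : ∀ m, (d+1+2*m).choose m = (d+2*m).choose m + if m = 0 then 0 else (d+2*m).choose (m-1) := by
    intro m
    rcases m with _ | m
    · simp
    · rw [show d+1+2*(m+1) = (d+2*(m+1))+1 by ring, Nat.choose_succ_succ]; simp [add_comm]
  have e2 : ∑ m ∈ Finset.range (M+1), al p (q-1) (d+2*m) * ((if m = 0 then 0 else (d+2*m).choose (m-1) : ℕ) : PowerSeries ℝ) * PowerSeries.X ^ m
     = PowerSeries.X * ∑ m ∈ Finset.range M, al p (q-1) (d+2+2*m) * (((d+2+2*m).choose m : ℕ) : PS) * PowerSeries.X ^ m := by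
    rw [Finset.sum_range_succ', Finset.mul_sum]
    simp only [if_true, Nat.cast_zero, mul_zero, zero_mul, add_zero]
    refine Finset.sum_congr rfl fun m _ => ?_
    rw [if_neg (by omega), Nat.add_sub_cancel, show d + 2*(m+1) = d+2+2*m by ring]
    ring
  rw [← e2, ← Finset.sum_add_distrib]
  simp only [Finset.mul_sum]
  rw [← Finset.sum_add_distrib]
  refine Finset.sum_congr rfl fun m _ => ?_
  rw [al_rec, if_neg (by omega), show d + 1 + 2*m - 1 = d+2*m by omega, e]
  push_cast
  ring

lemma TT_rec0 (p q M : ℕ) : TT (p+1) q 0 (M+1) = (1 + PowerSeries.X) * ((p:PS) * TT (p-1) q 0 (M+1)) +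
    (q:PS) * (2 * (PowerSeries.X * TT p (q-1) 1 M)) := by
  unfold TT
  have e : ∀ m, (0+2*(m+1)).choose (m+1) = 2 * (1+2*m).choose m := by
    intro m
    rw [show 0+2*(m+1) = (1+2*m)+1 by ring, Nat.choose_succ_succ, 
      Nat.choose_symm_of_eq_add (show 1+2*m = (m+1) + m by ring)]
    ring
  rw [Finset.sum_range_succ', Finset.sum_range_succ' _ M]
  simp only [Finset.mul_sum, mul_add]
  rw [add_right_comm, ← Finset.sum_add_distrib]
  congr 1
  · refine Finset.sum_congr rfl fun m _ => ?_
    rw [show 0 + (2*m+2*1) = 0 + 2*(m+1) by ring]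
    rw [al_rec, if_neg (by omega), e, show 0 + 2*(m+1) - 1 = 1+2*m by omega]
    push_cast
    ring
  · rw [al_rec]; simp

lemma TT_zero (p q d M : ℕ) (h : p < d) : TT p q d M = 0 := by
  unfold TT
  refine Finset.sum_eq_zero fun m _ => ?_
  rw [al_zero _ _ _ (by omega)]; simp

lemma VV_band (p q i j : ℕ) (h : j + p < i) : VV p q i j = 0 := by
  rw [VV_symm, VV, cc_band _ _ _ h, zero_mul]

lemma GG_zero (p q d : ℕ) (h : p < d) : GG p q d = 0 := by
  ext i; simp [GG, VV_band p q (i+d) i (by omega)]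

lemma GG_swap (p q d : ℕ) : GG p q d = GG q p d := by
  unfold GG; simp only [VV_swap p q]

lemma GG_base (q M : ℕ) : (1 - PowerSeries.X) ^ (q/2+1) * GG 0 q 0 = al 0 q 0 := by
  induction q using Nat.strong_induction_on with
  | _ q ih =>
    rcases q with _ | _ | q
    · have : GG 0 0 0 = PowerSeries.mk 1 := by
        unfold GG VV; congr 1; ext i; simp [cc]
      rw [this, mul_comm]
      simp [al, PowerSeries.mk_one_mul_one_sub_eq_one]
    · have := GG_rec0 0 0
      rw [GG_swap]
      simp [al] at this ⊢
      simp [this]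
    · have := GG_rec0 (q+1) 0
      rw [GG_swap, show (q+2)/2 = q/2+1 by omega, pow_succ, mul_assoc, this, al, ← ih q (by omega), GG_swap 0 q]
      simp; ring

theorem GG_TT (p q d M : ℕ) (h : p < d + 2 * M) : (1 - PowerSeries.X) ^ ((p+q)/2+1) * GG p q d = TT p q d M := by
  induction p using Nat.strong_induction_on generalizing q d M with
  | _ p ih =>
    rcases M with _ | M
    · rw [GG_zero _ _ _ (by omega), TT_zero _ _ _ _ (by omega), mul_zero]
    rcases p with _ | p
    · rcases d with _ | d
      · rw [zero_add, GG_base q 0, TT, Finset.sum_eq_single 0]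
        · simp
        · intro b _ hb; rw [al_0 _ _ (by omega)]; simp
        · simp
      · rw [GG_zero _ _ _ (by omega), TT_zero _ _ _ _ (by omega), mul_zero]
    · have A : ∀ d, d + 1 = d + 1 → p + 1 < d + 2*(M+1) → (p : PowerSeries ℝ) * TT (p-1) q d (M+1) = (1 - PowerSeries.X) ^ ((p+1+q)/2) * ((p:PS) * GG (p-1) q d) := by
        intro d _ hd
        rcases p with _ | p
        · simp
        · rw [← ih (p+1-1) (by omega) _ _ _ (by omega), show (p+1-1+q)/2+1 = (p+1+1+q)/2 by omega]; ring
      have B : ∀ d M, p < d + 2*M → (q : PowerSeries ℝ) * TT p (q-1) d M = (1 - PowerSeries.X) ^ ((p+1+q)/2) * ((q:PS) * GG p (q-1) d) := by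
        intro d M hd
        rcases q with _ | q
        · simp
        · rw [← ih p (by omega) _ _ _ hd, show (p+(q+1-1))/2+1 = (p+1+(q+1))/2 by omega]; ring
      rcases d with _ | d
      · rw [TT_rec0, A 0 rfl h, pow_succ, mul_assoc, GG_rec0]
        have := B 1 M (by omega)
        linear_combination - 2 * PowerSeries.X * this
      · rw [TT_recS, A (d+1) rfl h, pow_succ, mul_assoc, GG_recS]
        have b1 := B d (M+1) (by omega)
        have b2 := B (d+2) M (by omega)
        linear_combination - b1 - PowerSeries.X * b2

end JK

set_option linter.unusedSectionVars false
set_option linter.unusedSimpArgs false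
namespace JK
open MvPolynomial

lemma al_odd (p q s : ℕ) (h : (p + s) % 2 = 1) : al p q s = 0 := by
  induction p using Nat.strong_induction_on generalizing q s with
  | _ p ih =>
    rcases p with _ | p
    · exact al_0 q s (by omega)
    · rw [al_rec]
      have h1 : (p : PS) * al (p-1) q s = 0 := by
        rcases p with _ | p
        · simp
        · rw [ih (p+1-1) (by omega) _ _ (by omega), mul_zero]
      rw [h1]
      split_ifs with hs
      · simp
      · rw [ih p (by omega) _ _ (by omega)]; simp

noncomputable def PP (k l s : ℕ) : ℝ :=
  ((2*k+s).factorial : ℝ) * (2*l+s).factorial / (2^(k+l) * k.factorial * l.factorial * s.factorial)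

lemma natC (a : ℕ) : (a : PS) = PowerSeries.C (a : ℝ) := (map_natCast _ a).symm

lemma al_closed (k l s : ℕ) : al (2*k+s) (2*l+s) s = PowerSeries.C (PP k l s) * (1 + PowerSeries.X) ^ (k+l) := by
  induction s generalizing k l with
  | zero =>
    induction k with
    | zero =>
      induction l with
      | zero => simp [al, PP]
      | succ l ih =>
        have e : PP 0 (l+1) 0 = (2*l+1 : ℕ) * PP 0 l 0 := by
          unfold PP
          simp only [show 2*(l+1)+0 = 2*l+1+1 by ring, add_zero, mul_zero, zero_add, Nat.factorial_succ, pow_succ]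
          have := fne l
          have := fne (2*l)
          push_cast
          field_simp
          ring
        rw [e]
        simp only [mul_zero, add_zero] at ih ⊢
        rw [show 2*(l+1) = 2*l+2 by ring, al, ih, map_mul, natC]
        ring
    | succ k ih =>
      have e : PP (k+1) l 0 = (2*k+1 : ℕ) * PP k l 0 := by
        unfold PP
        simp only [show 2*(k+1)+0 = 2*k+1+1 by ring, add_zero, show k+1+l = k+l+1 by ring, Nat.factorial_succ, pow_succ]
        have := fne l
        have := fne k
        push_cast
        field_simp
        ring
      rw [e, show 2*(k+1)+0 = (2*k+1)+1 by ring, al_rec, if_pos rfl, Nat.add_sub_cancel, mul_zero, add_zero, map_mul, ← natC]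
      simp only [add_zero] at ih ⊢
      rw [ih]; ring
  | succ s ihs =>
    induction k with
    | zero =>
      have e : PP 0 l (s+1) = (2*l+s+1 : ℕ) * PP 0 l s := by
        unfold PP
        simp only [← add_assoc, mul_zero, zero_add, Nat.factorial_succ]
        have := fne l
        have := fne s
        push_cast
        field_simp
      rw [← add_assoc, al_rec, if_neg (by omega), al_zero (2*0+s-1) _ _ (by omega), ← add_assoc, Nat.add_sub_cancel,
        Nat.add_sub_cancel, ihs, e, map_mul, ← natC]
      ring
    | succ k ihk =>
      have e : PP (k+1) l (s+1) = (2*k+s+2 : ℕ) * PP k l (s+1) + (2*l+s+1 : ℕ) * PP (k+1) l s := by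
        unfold PP
        simp only [show 2*(k+1)+(s+1) = 2*k+s+1+1+1 by ring, show 2*(k+1)+s = 2*k+s+1+1 by ring,
          show 2*k+(s+1) = 2*k+s+1 by ring, show 2*l+(s+1) = 2*l+s+1 by ring, show k+1+l = k+l+1 by ring, Nat.factorial_succ, pow_succ]
        have := fne l
        have := fne k
        have := fne s
        push_cast
        field_simp
        ring
      have h1 := ihs (k+1) l
      rw [show 2*(k+1)+s = 2*k+(s+1)+1 by ring] at h1
      rw [show 2*(k+1)+(s+1) = (2*k+(s+1)+1)+1 by ring, al_rec, if_neg (by omega), Nat.add_sub_cancel, ihk,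
         ← add_assoc (2*l), Nat.add_sub_cancel, Nat.add_sub_cancel, h1, e, map_add, map_mul, map_mul, natC, natC]
      rw [show 2*k+(s+1)+1 = 2*k+s+2 by ring]
      ring

section Q
local notation "z" => (PowerSeries.X : PS)

noncomputable def qq (s M : ℕ) : PS := ∑ m ∈ Finset.range M, ((s.choose m : ℕ) : PS) * (z ^ m - z ^ (s - m))

lemma qq_rec (s M : ℕ) (h : M ≤ s) : qq (s+1) (M+1) = (1 + z) * qq s M + ((s.choose M : ℕ) : PS) * (z ^ M - z ^ (s+1-M)) := by
  have h1 : qq (s+1) (M+1) = ∑ m ∈ Finset.range (M+1), ((s.choose m : ℕ) : PS) * (z ^ m - z ^ (s+1-m)) +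
      ∑ m ∈ Finset.range M, ((s.choose m : ℕ) : PS) * (z ^ (m+1) - z ^ (s-m)) := by
    unfold qq
    rw [Finset.sum_range_succ', Finset.sum_range_succ' _ M, add_right_comm, ← Finset.sum_add_distrib]
    congr 1
    · refine Finset.sum_congr rfl fun m _ => ?_
      rw [Nat.choose_succ_succ, Nat.add_sub_add_right]
      push_cast; ring
    · simp
  rw [h1, Finset.sum_range_succ, qq, Finset.mul_sum, add_right_comm, ← Finset.sum_add_distrib]
  congr 1
  refine Finset.sum_congr rfl fun m hm => ?_
  have := Finset.mem_range.1 hm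
  rw [show s + 1 - m = (s - m) + 1 by omega]
  ring

lemma qq_succ (s M : ℕ) : qq s (M+1) = qq s M + ((s.choose M : ℕ) : PS) * (z ^ M - z ^ (s - M)) := by
  rw [qq, Finset.sum_range_succ, ← qq]

noncomputable def rr (s M : ℕ) : PS := ∑ j ∈ Finset.range M, (((2*j).choose j : ℕ) : PS) * z ^ j * (1 + z) ^ (s - 1 - 2*j)

lemma rr_succ (s M : ℕ) : rr s (M+1) = rr s M + (((2*M).choose M : ℕ) : PS) * z ^ M * (1 + z) ^ (s - 1 - 2*M) := by
  rw [rr, Finset.sum_range_succ, ← rr]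

lemma rr_step (s M : ℕ) (h : 2 * M ≤ s + 1) : rr (s+1) M = (1 + z) * rr s M := by
  unfold rr
  rw [Finset.mul_sum]
  refine Finset.sum_congr rfl fun j hj => ?_
  have := Finset.mem_range.1 hj
  rw [show s + 1 - 1 - 2*j = (s - 1 - 2*j) + 1 by omega]
  ring

lemma qr (r : ℕ) : qq (2*r) r = (1 - z) * rr (2*r) r ∧ qq (2*r+1) (r+1) = (1 - z) * rr (2*r+1) (r+1) := by
  have A : ∀ r, qq (2*r) r = (1 - z) * rr (2*r) r → qq (2*r+1) (r+1) = (1 - z) * rr (2*r+1) (r+1) := by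
    intro r h
    rw [qq_rec _ _ (by omega), h, rr_succ, rr_step _ _ (by omega),
      show 2*r+1-r = r+1 by omega, show 2*r+1-1-2*r = 0 by omega]
    ring
  induction r with
  | zero =>
    have : qq (2*0) 0 = (1 - z) * rr (2*0) 0 := by simp [qq, rr]
    exact ⟨this, A 0 this⟩
  | succ r ih =>
    have : qq (2*(r+1)) (r+1) = (1 - z) * rr (2*(r+1)) (r+1) := by
      rw [show 2*(r+1) = (2*r+1)+1 by ring, qq_rec _ _ (by omega), rr_step _ _ (by omega)]
      have h2 := ih.2
      rw [qq_succ, show 2*r+1-r = r+1 by omega] at h2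
      rw [show 2*r+1+1-r = r+2 by omega]
      linear_combination (1+z) * h2
    exact ⟨this, A _ this⟩

lemma qr' (s : ℕ) : qq s ((s+1)/2) = (1 - z) * rr s ((s+1)/2) := by
  obtain ⟨r, h | h⟩ := Nat.even_or_odd' s
  · rw [h, show (2*r+1)/2 = r by omega]; exact (qr r).1
  · rw [h, show (2*r+1+1)/2 = r+1 by omega]; exact (qr r).2

lemma shift_sum (n a : ℕ) (f : ℕ → PS) (ha : f a = 0) (hf : ∀ s, n < s → f s = 0) :
    ∑ d ∈ Finset.range (n+1), f (d + a) = ∑ s ∈ Finset.range (n+1), if a < s then f s else 0 := by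
  have h1 : ∑ d ∈ Finset.range (n+1), f (d + a) = ∑ s ∈ Finset.Ico a (a+(n+1)), f s := by
    rw [Finset.sum_Ico_eq_sum_range]
    simp [add_comm]
  rw [h1, ← Finset.sum_filter]
  symm
  apply Finset.sum_subset
  · intro s hs; simp at hs ⊢; omega
  · intro s h1 h2
    simp at h1 h2
    by_cases h3 : n < s
    · exact hf s h3
    · have : s = a := by have := h2 (by omega); omega
      rw [this, ha]

lemma even_sum (n : ℕ) (g : ℕ → PS) (hg : ∀ t ≤ n, t % 2 = 1 → g t = 0) :
    ∑ t ∈ Finset.range (n+1), g t = ∑ k ∈ Finset.range (n/2+1), g (2*k) := by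
  rw [← Finset.sum_image (s := Finset.range (n/2+1)) (g := fun k => 2*k) (f := g) (by intro a _ b _ h; simpa using h)]
  symm
  apply Finset.sum_subset
  · intro s hs; simp at hs ⊢; omega
  · intro s h1 h2
    apply hg _ (by simp at h1; omega)
    by_contra h3
    apply h2
    simp at h1 ⊢
    exact ⟨s/2, by omega, by omega⟩

lemma sumT (n : ℕ) : ∑ d ∈ Finset.range (n+1), (1 - z ^ d) * TT n n d (n+1) =
    ∑ k ∈ Finset.range (n/2+1), al n n (n-2*k) * qq (n-2*k) ((n-2*k+1)/2) := by
  let f : ℕ → ℕ → PS := fun m s => al n n s * ((s.choose m : ℕ) : PS) * (z ^ m - z ^ (s-m))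
  have h1 : ∑ d ∈ Finset.range (n+1), (1 - z ^ d) * TT n n d (n+1) =
      ∑ m ∈ Finset.range (n+1), ∑ d ∈ Finset.range (n+1), f m (d+2*m) := by
    rw [Finset.sum_comm]
    refine Finset.sum_congr rfl fun d _ => ?_
    rw [TT, Finset.mul_sum]
    refine Finset.sum_congr rfl fun m _ => ?_
    simp only [f]
    rw [show d + 2*m - m = d + m by omega]
    ring
  have h2 : ∀ s ∈ Finset.range (n+1), ∑ m ∈ Finset.range (n+1), (if 2*m < s then f m s else 0) = al n n s * qq s ((s+1)/2) := by
    intro s hs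
    have := Finset.mem_range.1 hs
    rw [← Finset.sum_filter, qq, Finset.mul_sum]
    have : Finset.filter (fun m => 2*m < s) (Finset.range (n+1)) = Finset.range ((s+1)/2) := by
      ext m; simp; omega
    rw [this]
    refine Finset.sum_congr rfl fun m _ => ?_
    simp only [f]; ring
  rw [h1, Finset.sum_congr rfl fun m _ => shift_sum n (2*m) (f m) (by simp [f, show 2*m-m = m by omega])
    (fun s hs => by simp [f, al_zero n n s hs]), Finset.sum_comm, Finset.sum_congr rfl h2, ← Finset.sum_range_reflect]
  simp only [Nat.add_sub_cancel]
  rw [even_sum n (fun t => al n n (n - t) * qq (n - t) ((n - t + 1)/2))]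
  intro t h ht
  simp [al_odd n n (n-t) (by omega)]

/-- the determinantal expression -/
noncomputable def BB (n N : ℕ) : ℝ := ∑ k ∈ Finset.range N, cc (n+n) k k
  - ∑ k ∈ Finset.range N, ∑ l ∈ Finset.range N, VV n n k l

lemma BB_step (n N : ℕ) : BB n (N+1) - BB n N =
    ∑ d ∈ Finset.range (n+1), (VV n n (N+d) N - if d ≤ N then VV n n N (N-d) else 0) := by
  have h1 : cc (n+n) N N = ∑ l ∈ Finset.range N, VV n n N l + ∑ d ∈ Finset.range (n+1), VV n n (N+d) N := by
    rw [cc_mul n n N N (N+(n+1)) (by omega), Finset.sum_range_add]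
    congr 1
    refine Finset.sum_congr rfl fun d _ => ?_
    rw [VV_symm]; rfl
  have h2 : ∑ d ∈ Finset.range (n+1), (if d ≤ N then VV n n N (N-d) else 0) =
      ∑ l ∈ Finset.range (N+1), VV n n N l := by
    rw [← Finset.sum_filter, ← Finset.sum_range_reflect]
    apply Finset.sum_subset_zero_on_sdiff
    · intro d; simp
    · intro d hd
      simp at hd
      apply VV_band
      omega
    · intro d hd; simp
  rw [Finset.sum_sub_distrib, h2]
  unfold BB
  rw [Finset.sum_range_succ, Finset.sum_range_succ (fun k => ∑ l ∈ Finset.range (N+1), VV n n k l)]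
  simp only [Finset.sum_range_succ, Finset.sum_add_distrib]
  have h3 : ∑ x ∈ Finset.range N, VV n n x N = ∑ x ∈ Finset.range N, VV n n N x :=
    Finset.sum_congr rfl fun x _ => VV_symm _ _ _ _
  rw [h1, h3, Finset.sum_range_succ]
  ring

lemma BB_ser (n : ℕ) : (1 - z) * PowerSeries.mk (BB n) = z * ∑ d ∈ Finset.range (n+1), (1 - z ^ d) * GG n n d := by
  ext N
  rcases N with _ | N
  · simp [sub_mul, BB]
  · rw [sub_mul, one_mul, map_sub, PowerSeries.coeff_succ_X_mul, PowerSeries.coeff_succ_X_mul, PowerSeries.coeff_mk,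
      PowerSeries.coeff_mk, BB_step, map_sum]
    refine Finset.sum_congr rfl fun d _ => ?_
    rw [sub_mul, one_mul, map_sub, PowerSeries.coeff_X_pow_mul']
    simp only [GG, PowerSeries.coeff_mk]
    congr 1
    split_ifs with h
    · rw [Nat.sub_add_cancel h]
    · rfl

lemma choose_ser (n a : ℕ) (h : a ≤ n) :
    (1 - z) ^ (n+1) * PowerSeries.mk (fun N => ((N+a).choose n : ℝ)) = z ^ (n-a) := by
  have h1 : PowerSeries.mk (fun N => ((N+a).choose n : ℝ)) = z ^ (n-a) * PowerSeries.mk 1 ^ (n+1) := by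
    rw [PowerSeries.mk_one_pow_eq_mk_choose_add]
    ext N
    rw [PowerSeries.coeff_X_pow_mul']
    simp only [PowerSeries.coeff_mk]
    split_ifs with h2
    · rw [show n + (N - (n-a)) = N + a by omega]
    · rw [Nat.choose_eq_zero_of_lt (by omega)]; simp
  rw [h1, mul_left_comm, ← mul_pow, mul_comm (1 - z), PowerSeries.mk_one_mul_one_sub_eq_one]
  simp

lemma PP_eq (n k : ℕ) (h : 2 * k ≤ n) : PP k k (n-2*k) = n.factorial * (((2 * k).choose k : ℝ) / 4 ^ k * (n.choose (2 * k) : ℝ)) := by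
  unfold PP
  rw [show 2*k+(n-2*k) = n by omega, Nat.cast_choose ℝ h, Nat.cast_choose ℝ (show k ≤ 2*k by omega),
    show 2*k-k = k by omega, ← two_mul, pow_mul]
  have := fne n
  have := fne k
  have := fne (2*k)
  have := fne (n-2*k)
  field_simp
  norm_num

lemma sum_i (n j : ℕ) (h : 2*j+1 ≤ n) : ∑ i ∈ Finset.range (n-2*j), (((n-2*j-1).choose i : ℕ) : PS) * z ^ (n-(j+i)) =
    z ^ (j+1) * (1 + z) ^ (n-1-2*j) := by
  rw [add_pow, Finset.mul_sum, show n - 1 - 2*j + 1 = n - 2*j by omega]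
  refine Finset.sum_congr rfl fun i hi => ?_
  have := Finset.mem_range.1 hi
  rw [show n - (j+i) = (j+1) + (n-1-2*j-i) by omega, pow_add, one_pow, show n - 2*j-1 = n-1-2*j by omega]
  ring

theorem BB_final (n : ℕ) (hn : 1 ≤ n) (N : ℕ) : BB n N = (n.factorial : ℝ) *
        ∑ j ∈ Finset.range ((n - 1) / 2 + 1), ∑ i ∈ Finset.range (n - 2 * j),
          ∑ k ∈ Finset.range ((n - 2 * j - 1) / 2 + 1),
            (((2 * k).choose k : ℝ) / 4 ^ k) * ((n.choose (2 * k) : ℝ)) *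
              (((2 * j).choose j : ℝ)) * (((n - 2 * j - 1).choose i : ℝ)) *
              ((N + (j + i)).choose n : ℝ) := by
  have hz : (1 - z) ≠ 0 := by
    intro h
    have := congrArg (PowerSeries.coeff 0) h
    simp at this
  have main : PowerSeries.mk (BB n) = ∑ j ∈ Finset.range ((n - 1) / 2 + 1), ∑ i ∈ Finset.range (n - 2 * j),
          ∑ k ∈ Finset.range ((n - 2 * j - 1) / 2 + 1), PowerSeries.C ((n.factorial : ℝ) *
            ((((2 * k).choose k : ℝ) / 4 ^ k) * ((n.choose (2 * k) : ℝ)) *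
              (((2 * j).choose j : ℝ)) * (((n - 2 * j - 1).choose i : ℝ)))) *
              PowerSeries.mk (fun N => ((N + (j + i)).choose n : ℝ)) := by
    apply mul_left_cancel₀ (pow_ne_zero (n+2) hz)
    have l1 : (1 - z) ^ (n+2) * PowerSeries.mk (BB n) = z * ∑ k ∈ Finset.range (n/2+1), al n n (n-2*k) * qq (n-2*k) ((n-2*k+1)/2) := by
      rw [← sumT, pow_succ, mul_assoc, BB_ser, mul_left_comm, Finset.mul_sum]
      congr 1
      refine Finset.sum_congr rfl fun d _ => ?_
      rw [← GG_TT n n d (n+1) (by omega), show (n+n)/2 = n by omega]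
      ring
    rw [l1]
    have l2 : ∀ j ∈ Finset.range ((n - 1) / 2 + 1), ∀ k : ℕ, (1 - z) ^ (n+2) * ∑ i ∈ Finset.range (n - 2 * j),
          PowerSeries.C ((n.factorial : ℝ) *
            ((((2 * k).choose k : ℝ) / 4 ^ k) * ((n.choose (2 * k) : ℝ)) *
              (((2 * j).choose j : ℝ)) * (((n - 2 * j - 1).choose i : ℝ)))) *
              PowerSeries.mk (fun N => ((N + (j + i)).choose n : ℝ)) =
          (1 - z) * (PowerSeries.C ((n.factorial : ℝ) *
            ((((2 * k).choose k : ℝ) / 4 ^ k) * ((n.choose (2 * k) : ℝ)))) * ((((2 * j).choose j : ℕ) : PS) * (z ^ (j+1) * (1 + z) ^ (n-1-2*j)))) := by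
      intro j hj k
      have hj := Finset.mem_range.1 hj
      rw [← sum_i n j (by omega), pow_succ', mul_assoc]
      congr 1
      simp only [Finset.mul_sum]
      refine Finset.sum_congr rfl fun i hi => ?_
      have hi := Finset.mem_range.1 hi
      rw [← choose_ser n (j+i) (by omega), natC, natC]
      simp only [map_mul]
      ring
    have l3 : (1 - z) ^ (n+2) * ∑ j ∈ Finset.range ((n - 1) / 2 + 1), ∑ i ∈ Finset.range (n - 2 * j),
          ∑ k ∈ Finset.range ((n - 2 * j - 1) / 2 + 1), PowerSeries.C ((n.factorial : ℝ) *
            ((((2 * k).choose k : ℝ) / 4 ^ k) * ((n.choose (2 * k) : ℝ)) *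
              (((2 * j).choose j : ℝ)) * (((n - 2 * j - 1).choose i : ℝ)))) *
              PowerSeries.mk (fun N => ((N + (j + i)).choose n : ℝ)) =
        ∑ j ∈ Finset.range ((n - 1) / 2 + 1), ∑ k ∈ Finset.range ((n - 2 * j - 1) / 2 + 1), 
          (1 - z) * (PowerSeries.C ((n.factorial : ℝ) *
            ((((2 * k).choose k : ℝ) / 4 ^ k) * ((n.choose (2 * k) : ℝ)))) * ((((2 * j).choose j : ℕ) : PS) * (z ^ (j+1) * (1 + z) ^ (n-1-2*j)))) := by
      rw [Finset.mul_sum]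
      refine Finset.sum_congr rfl fun j hj => ?_
      rw [Finset.sum_comm, Finset.mul_sum]
      exact Finset.sum_congr rfl fun k _ => l2 j hj k
    rw [l3, Finset.sum_comm' (t' := Finset.range (n/2+1)) (s' := fun k => Finset.range ((n-2*k+1)/2)), Finset.mul_sum]
    · refine Finset.sum_congr rfl fun k hk => ?_
      have hk := Finset.mem_range.1 hk
      have hal := al_closed k k (n-2*k)
      rw [show 2*k+(n-2*k) = n by omega, PP_eq n k (by omega)] at hal
      rw [hal, qr', rr]
      simp only [Finset.mul_sum]
      refine Finset.sum_congr rfl fun j hj => ?_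
      have hj := Finset.mem_range.1 hj
      rw [show n - 1 - 2*j = (k+k) + (n-2*k-1-2*j) by omega, pow_add (1+z)]
      ring
    · intro j k
      simp only [Finset.mem_range]
      omega
  have := congrArg (PowerSeries.coeff N) main
  simp only [PowerSeries.coeff_mk, map_sum, PowerSeries.coeff_C_mul] at this
  rw [this]
  simp only [Finset.mul_sum]
  refine Finset.sum_congr rfl fun j _ => Finset.sum_congr rfl fun i _ => Finset.sum_congr rfl fun k _ => ?_
  ring

end Q
end JK

set_option linter.unusedSectionVars false
set_option linter.unusedSimpArgs false
namespace JK

lemma realChoose_nat (m n : ℕ) : realChoose (m : ℝ) n = (m.choose n : ℝ) := by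
  unfold realChoose
  rw [div_eq_iff (fne n)]
  have := Nat.descFactorial_eq_factorial_mul_choose m n
  have h2 : ((m.descFactorial n : ℕ) : ℝ) = ∏ t ∈ Finset.range n, ((m:ℝ) - t) := by
    induction n with
    | zero => simp
    | succ n ih =>
      rw [Nat.descFactorial_succ, Finset.prod_range_succ, ← ih (Nat.descFactorial_eq_factorial_mul_choose m n)]
      push_cast
      by_cases h : n ≤ m
      · rw [Nat.cast_sub h]; ring
      · rw [Nat.descFactorial_eq_zero_iff_lt.2 (by omega)]; simp
  rw [← h2, this]; push_cast; ring

noncomputable def rcP (a : ℝ) (n : ℕ) : Polynomial ℝ :=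
  Polynomial.C ((n.factorial : ℝ)⁻¹) * ∏ t ∈ Finset.range n, (Polynomial.X + Polynomial.C (a - t))

lemma rcP_eval (a x : ℝ) (n : ℕ) : (rcP a n).eval x = realChoose (x + a) n := by
  unfold rcP realChoose
  rw [Polynomial.eval_mul, Polynomial.eval_prod, Polynomial.eval_C, div_eq_inv_mul]
  congr 1
  refine Finset.prod_congr rfl fun t _ => ?_
  simp; ring

lemma nat_case (n : ℕ) (hn : 1 ≤ n) (N : ℕ) :
    ∑ k ∈ Finset.Icc 1 (2 * n), (annTotal n n k : ℝ) * (N:ℝ) ^ k =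
      (n.factorial : ℝ) *
        ∑ j ∈ Finset.range ((n - 1) / 2 + 1), ∑ i ∈ Finset.range (n - 2 * j),
          ∑ k ∈ Finset.range ((n - 2 * j - 1) / 2 + 1),
            (((2 * k).choose k : ℝ) / 4 ^ k) * ((n.choose (2 * k) : ℝ)) *
              (((2 * j).choose j : ℝ)) * (((n - 2 * j - 1).choose i : ℝ)) *
              realChoose ((N:ℝ) + j + i) n := by
  obtain ⟨E, hE1, hE⟩ := exists_gauss (σ := Fin N × Fin N) Prod.swap Prod.swap_swap
  rw [ann_eq n hn E hE1 hE, mat_cc N n E hE1 hE]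
  have h := BB_final n hn N
  simp only [BB, VV, Finset.sum_range] at h
  rw [h]
  simp only [Finset.sum_range]
  congr 1
  refine Finset.sum_congr rfl fun j _ => Finset.sum_congr rfl fun i _ => Finset.sum_congr rfl fun k _ => ?_
  rw [← realChoose_nat (N + (_ + _)) n]
  push_cast
  rw [add_assoc]

end JK

theorem jackson_nn (n : ℕ) (hn : 1 ≤ n) (x : ℝ) :
    ∑ k ∈ Finset.Icc 1 (2 * n), (annTotal n n k : ℝ) * x ^ k =
      (n.factorial : ℝ) *
        ∑ j ∈ Finset.range ((n - 1) / 2 + 1), ∑ i ∈ Finset.range (n - 2 * j),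
          ∑ k ∈ Finset.range ((n - 2 * j - 1) / 2 + 1),
            (((2 * k).choose k : ℝ) / 4 ^ k) * ((n.choose (2 * k) : ℝ)) *
              (((2 * j).choose j : ℝ)) * (((n - 2 * j - 1).choose i : ℝ)) *
              realChoose (x + j + i) n := by
  let P : Polynomial ℝ := ∑ k ∈ Finset.Icc 1 (2 * n), Polynomial.C (annTotal n n k : ℝ) * Polynomial.X ^ k
  let Q : Polynomial ℝ := Polynomial.C (n.factorial : ℝ) *
        ∑ j ∈ Finset.range ((n - 1) / 2 + 1), ∑ i ∈ Finset.range (n - 2 * j),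
          ∑ k ∈ Finset.range ((n - 2 * j - 1) / 2 + 1),
            Polynomial.C ((((2 * k).choose k : ℝ) / 4 ^ k) * ((n.choose (2 * k) : ℝ)) *
              (((2 * j).choose j : ℝ)) * (((n - 2 * j - 1).choose i : ℝ))) *
              JK.rcP ((j:ℝ) + i) n
  have hP : ∀ y : ℝ, P.eval y = ∑ k ∈ Finset.Icc 1 (2 * n), (annTotal n n k : ℝ) * y ^ k := by
    intro y
    simp only [P, Polynomial.eval_finsetSum, Polynomial.eval_mul, Polynomial.eval_C, Polynomial.eval_pow, Polynomial.eval_X]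
  have hQ : ∀ y : ℝ, Q.eval y = (n.factorial : ℝ) *
        ∑ j ∈ Finset.range ((n - 1) / 2 + 1), ∑ i ∈ Finset.range (n - 2 * j),
          ∑ k ∈ Finset.range ((n - 2 * j - 1) / 2 + 1),
            (((2 * k).choose k : ℝ) / 4 ^ k) * ((n.choose (2 * k) : ℝ)) *
              (((2 * j).choose j : ℝ)) * (((n - 2 * j - 1).choose i : ℝ)) *
              realChoose (y + j + i) n := by
    intro y
    simp only [Q, Polynomial.eval_finsetSum, Polynomial.eval_mul, Polynomial.eval_C, JK.rcP_eval, ← add_assoc]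
  have hPQ : P = Q := by
    apply Polynomial.eq_of_infinite_eval_eq
    apply Set.Infinite.mono _ (Set.infinite_range_of_injective (Nat.cast_injective (R := ℝ)))
    rintro _ ⟨N, rfl⟩
    show P.eval _ = Q.eval _
    rw [hP, hQ]
    exact JK.nat_case n hn N
  rw [← hP, ← hQ, hPQ]
end
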